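/- arXiv:1905.10879 — 3 statements merged into one kernel-verified Lean document; each statement's English description precedes it below -/
import Mathlib

section
/- Let N ≥ 4 be an integer. The real Koba-Nielsen local zeta function Z^(N)(s) converges (i.e., the integrand is absolutely integrable over ℝ^{N-3}) and defines a holomorphic function of s on the open set of all s = (s_{ij}) ∈ ℂ^{N(N-3)/2} satisfying −2/(N−2) < Re(s_{ij}) < −2/N for every index pair ij. -/
open MeasureTheory Finset

/-- The integrand of the real Koba-Nielsen local zeta function `Z^(N)(s)`.
The variables `x 0, …, x (N-4)` represent `x_2, …, x_{N-2}`; `a j` is `s_{1,(j+2)}`,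
`b j` is `s_{(N-1),(j+2)}`, and `c i j` (for `i < j`) is `s_{(i+2),(j+2)}`.
For `t ≠ 0`, `(|t| : ℂ) ^ s = |t|^{Re s} e^{i Im s log |t|}`. -/
noncomputable def KNintegrand (N : ℕ) (a b : Fin (N - 3) → ℂ)
    (c : Fin (N - 3) → Fin (N - 3) → ℂ) (x : Fin (N - 3) → ℝ) : ℂ :=
  (∏ j, ((|x j| : ℝ) : ℂ) ^ a j) * (∏ j, ((|1 - x j| : ℝ) : ℂ) ^ b j) *
    ∏ p ∈ Finset.univ.filter (fun p : Fin (N - 3) × Fin (N - 3) => p.1 < p.2),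
      ((|x p.1 - x p.2| : ℝ) : ℂ) ^ c p.1 p.2

/-- The open band `lo < Re(s_{ij}) < hi` for all relevant index pairs `ij`. -/
def KNregion (N : ℕ) (lo hi : ℝ) :
    Set ((Fin (N - 3) → ℂ) × (Fin (N - 3) → ℂ) × (Fin (N - 3) → Fin (N - 3) → ℂ)) :=
  {s | (∀ j, lo < (s.1 j).re ∧ (s.1 j).re < hi) ∧
       (∀ j, lo < (s.2.1 j).re ∧ (s.2.1 j).re < hi) ∧
       (∀ i j, i < j → lo < (s.2.2 i j).re ∧ (s.2.2 i j).re < hi)}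

open scoped ENNReal

/-- Iterated Tonelli bound: if each factor `k i` has mass at most `M` in its own variable, and does
not depend on the variables of equal or larger rank, the product has mass at most `M ^ card`. -/
theorem lmarginal_prod_le {ι : Type*} [DecidableEq ι] (k : ι → (ι → ℝ) → ℝ≥0∞) (r : ι → ℕ)
    (M : ℝ≥0∞) (hk : ∀ i, Measurable (k i))
    (hM : ∀ i x, ∫⁻ t, k i (Function.update x i t) ≤ M)
    (hdep : ∀ i j, i ≠ j → r j ≤ r i → ∀ x t, k j (Function.update x i t) = k j x)
    (s : Finset ι) : ∀ (C : ℝ≥0∞) (x : ι → ℝ),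
      lmarginal (fun _ => (volume : Measure ℝ)) s (fun x => C * ∏ i ∈ s, k i x) x
        ≤ C * M ^ s.card := by
  induction s using Finset.induction_on_max_value r with
  | empty => simp
  | insert a s ha hmax ih =>
    intro C x
    have hmeas : Measurable fun x => C * ∏ i ∈ insert a s, k i x :=
      measurable_const.mul (Finset.measurable_prod _ fun i _ => hk i)
    rw [lmarginal_insert' _ hmeas ha]
    refine (lmarginal_mono (g := fun x => (C * M) * ∏ i ∈ s, k i x) ?_ x).trans
      ((ih (C * M) x).trans_eq ?_)
    · intro x
      have hs : ∀ t, ∏ i ∈ s, k i (Function.update x a t) = ∏ i ∈ s, k i x := fun t =>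
        Finset.prod_congr rfl fun i hi =>
          hdep a i (fun h => ha (h ▸ hi)) (hmax i hi) x t
      simp only [Finset.prod_insert ha, hs]
      calc ∫⁻ t, C * (k a (Function.update x a t) * ∏ i ∈ s, k i x)
          = ∫⁻ t, (C * ∏ i ∈ s, k i x) * k a (Function.update x a t) := by
            congr 1; ext t; ring
        _ = (C * ∏ i ∈ s, k i x) * ∫⁻ t, k a (Function.update x a t) :=
            lintegral_const_mul _ ((hk a).comp (measurable_update x))
        _ ≤ (C * ∏ i ∈ s, k i x) * M := by gcongr; exact hM a x
        _ = C * M * ∏ i ∈ s, k i x := by ring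
    · rw [Finset.card_insert_of_notMem ha]; ring

/-- The term attached to the vertex `i` in a star on the vertex set `Option ι` with the given
centre, where `none` is the root: the edge from `i` to the root carries `g i (x i)` and the edge
from `i` to another vertex `c` carries `h i (x i) (x c)`. -/
def starTerm {ι α : Type*} [DecidableEq ι] (g : ι → ℝ → α) (h : ι → ℝ → ℝ → α) :
    Option ι → (ι → ℝ) → ι → α
  | none, x, i => g i (x i)
  | some c, x, i => if i = c then g i (x i) else h i (x i) (x c)

theorem starTerm_comp {ι α β : Type*} [DecidableEq ι] (φ : α → β) (g : ι → ℝ → α)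
    (h : ι → ℝ → ℝ → α) (c : Option ι) (x : ι → ℝ) (i : ι) :
    φ (starTerm g h c x i) = starTerm (fun i t => φ (g i t)) (fun i t v => φ (h i t v)) c x i := by
  cases c with
  | none => rfl
  | some c => simp only [starTerm]; split_ifs <;> rfl

theorem measurable_starTerm {ι : Type*} [DecidableEq ι] {α : Type*} [MeasurableSpace α]
    {g : ι → ℝ → α} {h : ι → ℝ → ℝ → α} (hg : ∀ i, Measurable (g i))
    (hh : ∀ i, Measurable (Function.uncurry (h i))) (c : Option ι) (i : ι) :
    Measurable fun x => starTerm g h c x i := by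
  cases c with
  | none => exact (hg i).comp (measurable_pi_apply i)
  | some c =>
    simp only [starTerm]
    split_ifs
    · exact (hg i).comp (measurable_pi_apply i)
    · exact (hh i).comp (f := fun x : ι → ℝ => (x i, x c)) (by fun_prop)

theorem lintegral_prod_starTerm_le {ι : Type*} [Fintype ι] [DecidableEq ι] {g : ι → ℝ → ℝ≥0∞}
    {h : ι → ℝ → ℝ → ℝ≥0∞} (hg : ∀ i, Measurable (g i))
    (hh : ∀ i, Measurable (Function.uncurry (h i))) {M : ℝ≥0∞} (hgM : ∀ i, ∫⁻ t, g i t ≤ M)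
    (hhM : ∀ i v, ∫⁻ t, h i t v ≤ M) (c : Option ι) :
    ∫⁻ x, ∏ i, starTerm g h c x i ≤ M ^ Fintype.card ι := by
  have key := lmarginal_prod_le (fun i x => starTerm g h c x i)
    (fun i => if c = none ∨ c = some i then 0 else 1) M (measurable_starTerm hg hh c) ?_ ?_
    Finset.univ 1 0
  · simpa [volume_pi] using key
  · intro i x
    cases c with
    | none => simpa [starTerm] using hgM i
    | some c =>
      by_cases hc : i = c
      · simpa [starTerm, hc] using hgM c
      · simpa [starTerm, hc, Function.update_of_ne (Ne.symm hc)] using hhM i (x c)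
  · intro i j hij hr x t
    cases c with
    | none => simp [starTerm, Function.update_of_ne hij.symm]
    | some c =>
      by_cases hj : j = c
      · simp [starTerm, hj, Function.update_of_ne (hj ▸ hij.symm)]
      · have hi : i ≠ c := by
          rintro rfl
          simp [Ne.symm hj] at hr
        simp [starTerm, hj, Function.update_of_ne hij.symm, Function.update_of_ne hi.symm]

section StarSum

variable {ι : Type*} [Fintype ι] [LinearOrder ι]

theorem two_mul_sum_lt {P : ι → ι → ℝ} (hP : ∀ i j, P i j = P j i) :
    2 * ∑ p ∈ univ.filter (fun p : ι × ι => p.1 < p.2), P p.1 p.2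
      = ∑ c, ∑ i, if i = c then 0 else P i c := by
  have hswap : ∑ p ∈ univ.filter (fun p : ι × ι => p.2 < p.1), P p.1 p.2
      = ∑ p ∈ univ.filter (fun p : ι × ι => p.1 < p.2), P p.1 p.2 := by
    refine Finset.sum_nbij' Prod.swap Prod.swap ?_ ?_ ?_ ?_ ?_ <;> simp [hP]
  rw [two_mul]
  nth_rewrite 1 [← hswap]
  rw [← Fintype.sum_prod_type' (fun c i => if i = c then 0 else P i c), Finset.sum_filter,
    Finset.sum_filter, ← Finset.sum_add_distrib]
  refine Finset.sum_congr rfl fun p _ => ?_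
  rcases lt_trichotomy p.1 p.2 with h | h | h
  · simp [h, h.ne', h.not_gt, hP p.1]
  · simp [h]
  · simp [h, h.ne, h.not_gt, hP p.1]

theorem sum_starTerm (g : ℝ → ℝ) (h : ℝ → ℝ) (hh : ∀ t, h (-t) = h t) (x : ι → ℝ) :
    ∑ c : Option ι, ∑ i, starTerm (fun _ => g) (fun _ t v => h (t - v)) c x i
      = 2 * ∑ i, g (x i)
        + 2 * ∑ p ∈ univ.filter (fun p : ι × ι => p.1 < p.2), h (x p.1 - x p.2) := by
  rw [two_mul_sum_lt (P := fun i j => h (x i - x j)) fun i j => by rw [← hh, neg_sub],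
    Fintype.sum_option]
  have hc : ∀ c, ∑ i, starTerm (fun _ => g) (fun _ t v => h (t - v)) (some c) x i
      = g (x c) + ∑ i, if i = c then 0 else h (x i - x c) := by
    intro c
    have : ∀ i, starTerm (fun _ => g) (fun _ t v => h (t - v)) (some c) x i
        = (if i = c then g (x i) else 0) + (if i = c then 0 else h (x i - x c)) := by
      intro i
      simp only [starTerm]
      split_ifs <;> simp
    simp only [this, Finset.sum_add_distrib]
    simp
  simp only [hc, Finset.sum_add_distrib]
  simp only [starTerm]
  ring

/-- Some star carries at least the average share of the total edge weight. -/
theorem exists_le_sum_starTerm (g : ℝ → ℝ) (h : ℝ → ℝ) (hh : ∀ t, h (-t) = h t) (x : ι → ℝ) :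
    ∃ c : Option ι, ∑ i, g (x i)
        + ∑ p ∈ univ.filter (fun p : ι × ι => p.1 < p.2), h (x p.1 - x p.2)
      ≤ (Fintype.card ι + 1) / 2 *
        ∑ i, starTerm (fun _ => g) (fun _ t v => h (t - v)) c x i := by
  by_contra! hcon
  have := Finset.sum_lt_sum_of_nonempty (s := (univ : Finset (Option ι))) ⟨none, mem_univ _⟩
    fun c _ => hcon c
  rw [← Finset.mul_sum, sum_starTerm g h hh] at this
  simp only [sum_const, card_univ, Fintype.card_option, nsmul_eq_mul] at this
  push_cast at this
  nlinarith

/-- If edges to the root count twice, some star carries at most its share of the total weight. -/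
theorem exists_sum_starTerm_le (g : ℝ → ℝ) (h : ℝ → ℝ) (hh : ∀ t, h (-t) = h t) (x : ι → ℝ) :
    ∃ c : Option ι, (Fintype.card ι + 3) / 2 *
        ∑ i, starTerm (fun _ => g) (fun _ t v => h (t - v)) c x i ≤ 2 * ∑ i, g (x i)
        + ∑ p ∈ univ.filter (fun p : ι × ι => p.1 < p.2), h (x p.1 - x p.2) := by
  by_contra! hcon
  have := Finset.sum_lt_sum_of_nonempty (s := (univ : Finset (Option ι))) ⟨none, mem_univ _⟩
    fun c _ => hcon c
  have h0 := hcon none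
  rw [← Finset.mul_sum, sum_starTerm g h hh] at this
  simp only [sum_const, card_univ, Fintype.card_option, nsmul_eq_mul] at this
  simp only [starTerm] at h0
  push_cast at this
  nlinarith

end StarSum

/-- The logarithmic singularity of the kernel `|t| ^ (-b)` at the origin. -/
noncomputable def logPole (t : ℝ) : ℝ := max 0 (-Real.log t)

/-- The logarithmic growth governing the decay of `|t| ^ (-a)` at infinity. -/
noncomputable def logGrowth (t : ℝ) : ℝ := Real.log (1 + |t|)

@[fun_prop]
theorem measurable_logPole : Measurable logPole := by unfold logPole; fun_prop

@[fun_prop]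
theorem measurable_logGrowth : Measurable logGrowth := by unfold logGrowth; fun_prop

theorem logPole_neg (t : ℝ) : logPole (-t) = logPole t := by simp [logPole]

theorem logGrowth_neg (t : ℝ) : logGrowth (-t) = logGrowth t := by simp [logGrowth]

theorem logPole_eq_zero {t : ℝ} (ht : 1 ≤ |t|) : logPole t = 0 := by
  rw [logPole, ← Real.log_abs]
  exact max_eq_left (by linarith [Real.log_nonneg ht])

theorem logPole_le_log_two {t : ℝ} (ht : 1 / 2 ≤ |t|) : logPole t ≤ Real.log 2 := by
  rw [logPole, ← Real.log_abs]
  refine max_le (Real.log_nonneg (by norm_num)) ?_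
  have := Real.log_le_log (by norm_num) ht
  rw [one_div, Real.log_inv] at this
  linarith

theorem logGrowth_le_add_log {s t k : ℝ} (hk : 0 ≤ k) (h : |s - t| ≤ k) :
    logGrowth s ≤ logGrowth t + Real.log (1 + k) := by
  rw [logGrowth, logGrowth, ← Real.log_mul (by positivity) (by positivity)]
  refine Real.log_le_log (by positivity) ?_
  have := abs_sub_abs_le_abs_sub s t
  nlinarith [abs_nonneg t]

/-- The unit-scale cutoff around a real number. -/
noncomputable def unitCutoff (s t : ℝ) : ℝ≥0∞ := if |s - t| ≤ 1 then 1 else 0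

@[fun_prop]
theorem measurable_unitCutoff : Measurable (Function.uncurry unitCutoff) :=
  Measurable.ite (measurableSet_le (by fun_prop) (by fun_prop)) measurable_const measurable_const

theorem exists_lintegral_logPole_le {q : ℝ} (hq : q < 1) :
    ∃ J : ℝ≥0∞, J < ∞ ∧ ∀ s z : ℝ,
      ∫⁻ t, unitCutoff s t * ENNReal.ofReal (Real.exp (q * logPole (t - z))) ≤ J := by
  set θ : ℝ → ℝ≥0∞ := (Metric.ball (0 : ℝ) 1).indicator
    fun t => ENNReal.ofReal (Real.exp (q * logPole t)) with hθ
  have hint : IntegrableOn (fun t => Real.exp (q * logPole t)) (Metric.ball (0 : ℝ) 1) := by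
    refine integrableOn_ball_of_norm_le_rpow (C := 1) (α := q) (by simp) (by simpa using hq) ?_
      (by fun_prop : Measurable _).aestronglyMeasurable
    filter_upwards [ae_restrict_mem Metric.isOpen_ball.measurableSet,
      ae_restrict_of_ae (Measure.ae_ne volume (0 : ℝ))] with t ht ht0
    have h1 : |t| < 1 := by simpa using ht
    have h0 : 0 < |t| := abs_pos.2 ht0
    rw [Real.norm_of_nonneg (Real.exp_pos _).le, one_mul, Real.norm_eq_abs, Real.rpow_def_of_pos h0,
      logPole, ← Real.log_abs, max_eq_right (by linarith [Real.log_neg h0 h1])]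
    exact Real.exp_le_exp.2 (by linarith)
  have hJ : ∫⁻ t, θ t < ∞ := by
    rw [hθ, lintegral_indicator Metric.isOpen_ball.measurableSet]
    exact hint.lintegral_lt_top
  refine ⟨2 + ∫⁻ t, θ t, by finiteness, fun s z => ?_⟩
  have hle : ∀ t, unitCutoff s t * ENNReal.ofReal (Real.exp (q * logPole (t - z)))
      ≤ (Metric.closedBall s 1).indicator 1 t + θ (t - z) := by
    intro t
    by_cases hs : |s - t| ≤ 1
    · have hmem : t ∈ Metric.closedBall s 1 := by
        rwa [Metric.mem_closedBall, dist_comm, Real.dist_eq]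
      by_cases hz : t - z ∈ Metric.ball (0 : ℝ) 1
      · simp [unitCutoff, hs, hθ, Set.indicator_of_mem hz]
      · have : logPole (t - z) = 0 := logPole_eq_zero (by simpa using hz)
        simp [unitCutoff, hs, Set.indicator_of_mem hmem, this]
    · simp [unitCutoff, hs]
  calc _ ≤ ∫⁻ t, (Metric.closedBall s 1).indicator 1 t + θ (t - z) := lintegral_mono hle
    _ = (∫⁻ t, (Metric.closedBall s 1).indicator 1 t) + ∫⁻ t, θ (t - z) :=
        lintegral_add_left (measurable_one.indicator Metric.isClosed_closedBall.measurableSet) _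
    _ = 2 + ∫⁻ t, θ t := by
        rw [lintegral_indicator_one Metric.isClosed_closedBall.measurableSet,
          lintegral_sub_right_eq_self θ z, Real.volume_closedBall]
        simp

theorem lintegral_logGrowth_lt_top {p : ℝ} (hp : 1 < p) :
    ∫⁻ t, ENNReal.ofReal (Real.exp (-p * logGrowth t)) < ∞ := by
  have h := integrable_one_add_norm (E := ℝ) (μ := volume) (r := p) (by simpa using hp)
  refine lt_of_le_of_lt (lintegral_mono fun t => ?_) h.lintegral_lt_top
  rw [Real.rpow_def_of_pos (by positivity), Real.norm_eq_abs, logGrowth, mul_comm]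

/-- The larger of the logarithmic singularities at the two fixed points `0` and `1`. -/
noncomputable def rootPole (t : ℝ) : ℝ := max (logPole t) (logPole (t - 1))

@[fun_prop]
theorem measurable_rootPole : Measurable rootPole := by unfold rootPole; fun_prop

theorem logPole_add_le_rootPole (t : ℝ) :
    logPole t + logPole (1 - t) ≤ rootPole t + Real.log 2 := by
  rw [← neg_sub t 1, logPole_neg, rootPole]
  rcases le_total (1 / 2) |t| with h | h
  · linarith [logPole_le_log_two h, le_max_right (logPole t) (logPole (t - 1))]
  · have : 1 / 2 ≤ |t - 1| := by
      have := abs_sub_abs_le_abs_sub 1 t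
      rw [abs_one, abs_sub_comm] at this
      linarith
    linarith [logPole_le_log_two this, le_max_left (logPole t) (logPole (t - 1))]

section Majorant

variable {ι : Type*} [Fintype ι] [LinearOrder ι]

theorem ofReal_exp_le_sum_prod_starTerm {X q : ℝ} (g : ι → ℝ → ℝ) (h : ι → ℝ → ℝ → ℝ)
    (x : ι → ℝ) (hX : ∃ c : Option ι, X ≤ q * ∑ i, starTerm g h c x i) :
    ENNReal.ofReal (Real.exp X) ≤ ∑ c : Option ι, ∏ i,
      starTerm (fun i t => ENNReal.ofReal (Real.exp (q * g i t)))
        (fun i t v => ENNReal.ofReal (Real.exp (q * h i t v))) c x i := by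
  obtain ⟨c, hc⟩ := hX
  refine le_trans ?_ (Finset.single_le_sum (fun _ _ => zero_le) (Finset.mem_univ c))
  simp only [← starTerm_comp fun t => ENNReal.ofReal (Real.exp (q * t))]
  rw [← ENNReal.ofReal_prod_of_nonneg fun i _ => (Real.exp_pos _).le, ← Real.exp_sum,
    ← Finset.mul_sum]
  exact ENNReal.ofReal_le_ofReal (Real.exp_le_exp.2 hc)

/-- The total logarithmic singularity of a configuration. -/
noncomputable def totalPole (x : ι → ℝ) : ℝ :=
  ∑ i, rootPole (x i) + ∑ p ∈ univ.filter (fun p : ι × ι => p.1 < p.2), logPole (x p.1 - x p.2)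

/-- The total logarithmic growth of a configuration. -/
noncomputable def totalGrowth (x : ι → ℝ) : ℝ :=
  2 * ∑ i, logGrowth (x i)
    + ∑ p ∈ univ.filter (fun p : ι × ι => p.1 < p.2), logGrowth (x p.1 - x p.2)

@[fun_prop]
theorem measurable_totalPole : Measurable (totalPole (ι := ι)) := by unfold totalPole; fun_prop

@[fun_prop]
theorem measurable_totalGrowth : Measurable (totalGrowth (ι := ι)) := by
  unfold totalGrowth; fun_prop

theorem lintegral_totalGrowth_lt_top {a : ℝ} (ha : 2 / ((Fintype.card ι : ℝ) + 3) < a) :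
    ∫⁻ x : ι → ℝ, ENNReal.ofReal (Real.exp (-a * totalGrowth x)) < ∞ := by
  set p : ℝ := a * ((Fintype.card ι + 3) / 2) with hp_def
  have hp : 1 < p := by
    rw [div_lt_iff₀ (by positivity)] at ha
    rw [hp_def]; linarith
  have ha0 : 0 ≤ a := le_trans (by positivity) ha.le
  set M := ∫⁻ t, ENNReal.ofReal (Real.exp (-p * logGrowth t)) with hM
  have hMfin : M < ∞ := lintegral_logGrowth_lt_top hp
  refine lt_of_le_of_lt (lintegral_mono fun x => ofReal_exp_le_sum_prod_starTerm (q := -p)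
    (fun _ => logGrowth) (fun _ t v => logGrowth (t - v)) x ?_) ?_
  · obtain ⟨c, hc⟩ := exists_sum_starTerm_le logGrowth logGrowth logGrowth_neg x
    refine ⟨c, ?_⟩
    have := mul_le_mul_of_nonneg_left hc ha0
    rw [totalGrowth, hp_def]
    linarith
  · have hg : ∀ _ : ι, Measurable fun t => ENNReal.ofReal (Real.exp (-p * logGrowth t)) :=
      fun _ => by fun_prop
    have hh : ∀ _ : ι, Measurable (Function.uncurry fun t v : ℝ =>
        ENNReal.ofReal (Real.exp (-p * logGrowth (t - v)))) := fun _ => by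
      unfold Function.uncurry; fun_prop
    rw [lintegral_finsetSum _ fun c _ =>
      Finset.measurable_prod _ fun i _ => measurable_starTerm hg hh c i]
    refine ENNReal.sum_lt_top.2 fun c _ => lt_of_le_of_lt
      (lintegral_prod_starTerm_le hg hh (M := M) (fun _ => le_rfl) (fun _ v => ?_) c)
      (by finiteness)
    rw [lintegral_sub_right_eq_self
      (fun t => ENNReal.ofReal (Real.exp (-p * logGrowth t))) v]

theorem prod_mul_starTerm (w : ι → ℝ → ℝ≥0∞) (g : ι → ℝ → ℝ≥0∞) (h : ι → ℝ → ℝ → ℝ≥0∞)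
    (c : Option ι) (x : ι → ℝ) :
    (∏ i, w i (x i)) * ∏ i, starTerm g h c x i
      = ∏ i, starTerm (fun i t => w i t * g i t) (fun i t v => w i t * h i t v) c x i := by
  rw [← Finset.prod_mul_distrib]
  refine Finset.prod_congr rfl fun i _ => ?_
  cases c with
  | none => rfl
  | some c => simp only [starTerm]; split_ifs <;> rfl

theorem exists_lintegral_totalPole_le {b : ℝ} (hb0 : 0 ≤ b)
    (hb : b < 2 / ((Fintype.card ι : ℝ) + 1)) :
    ∃ J : ℝ≥0∞, J < ∞ ∧ ∀ x : ι → ℝ, ∫⁻ y : ι → ℝ,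
      (∏ i, unitCutoff (x i) (y i)) * ENNReal.ofReal (Real.exp (b * totalPole y)) ≤ J := by
  set q : ℝ := b * ((Fintype.card ι + 1) / 2) with hq_def
  have hq : q < 1 := by
    rw [lt_div_iff₀ (by positivity)] at hb
    rw [hq_def]; linarith
  have hq0 : 0 ≤ q := by positivity
  obtain ⟨J, hJ, hJle⟩ := exists_lintegral_logPole_le hq
  refine ⟨∑ _c : Option ι, (J + J) ^ Fintype.card ι,
    ENNReal.sum_lt_top.2 fun _ _ => by finiteness, fun x => ?_⟩
  set w : ι → ℝ → ℝ≥0∞ := fun i t => unitCutoff (x i) t with hw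
  have hwm : ∀ i, Measurable (w i) := fun i =>
    measurable_unitCutoff.comp (measurable_const.prodMk measurable_id)
  have hle : ∀ y : ι → ℝ, ENNReal.ofReal (Real.exp (b * totalPole y)) ≤ _ := fun y =>
    ofReal_exp_le_sum_prod_starTerm (q := q) (fun _ => rootPole) (fun _ t v => logPole (t - v)) y
      (by
        obtain ⟨c, hc⟩ := exists_le_sum_starTerm rootPole logPole logPole_neg y
        refine ⟨c, ?_⟩
        have := mul_le_mul_of_nonneg_left hc hb0
        rw [totalPole, hq_def]
        linarith)
  refine (lintegral_mono fun y => mul_le_mul_right (hle y) (∏ i, w i (y i))).trans ?_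
  simp only [Finset.mul_sum, prod_mul_starTerm w]
  have hg : ∀ i : ι, Measurable fun t =>
      w i t * ENNReal.ofReal (Real.exp (q * rootPole t)) := fun i => by fun_prop
  have hh : ∀ i : ι, Measurable (Function.uncurry fun t v : ℝ =>
      w i t * ENNReal.ofReal (Real.exp (q * logPole (t - v)))) := fun i => by
    unfold Function.uncurry; fun_prop
  rw [lintegral_finsetSum _ fun c _ =>
    Finset.measurable_prod _ fun i _ => measurable_starTerm hg hh c i]
  refine Finset.sum_le_sum fun c _ => lintegral_prod_starTerm_le hg hh (fun i => ?_)
    (fun i v => (hJle (x i) v).trans le_self_add) c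
  refine (lintegral_mono (g := fun t =>
    w i t * ENNReal.ofReal (Real.exp (q * logPole (t - 0)))
      + w i t * ENNReal.ofReal (Real.exp (q * logPole (t - 1)))) fun t => ?_).trans ?_
  · dsimp only
    rw [← mul_add, ← ENNReal.ofReal_add (Real.exp_pos _).le (Real.exp_pos _).le, sub_zero]
    gcongr
    rw [rootPole]
    rcases max_choice (logPole t) (logPole (t - 1)) with h | h <;> rw [h] <;>
      linarith [Real.exp_pos (q * logPole t), Real.exp_pos (q * logPole (t - 1))]
  · rw [lintegral_add_left (by fun_prop)]
    exact add_le_add (hJle (x i) 0) (hJle (x i) 1)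

/-- The logarithm of `max (|t| ^ (-a)) (|t| ^ (-b))`. -/
noncomputable def logEdge (a b t : ℝ) : ℝ := max (-a * Real.log t) (-b * Real.log t)

@[fun_prop]
theorem measurable_logEdge (a b : ℝ) : Measurable (logEdge a b) := by unfold logEdge; fun_prop

theorem logEdge_le {a b : ℝ} (ha : 0 ≤ a) (hab : a ≤ b) (t : ℝ) :
    logEdge a b t ≤ b * logPole t - a * logGrowth t + a * Real.log 2 := by
  have h2 : 0 ≤ Real.log 2 := Real.log_nonneg (by norm_num)
  rw [logEdge, logPole, logGrowth, ← Real.log_abs]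
  rcases eq_or_ne t 0 with rfl | ht
  · simp; positivity
  have ht0 : 0 < |t| := abs_pos.2 ht
  rcases le_total 1 |t| with h | h
  · have hl := Real.log_nonneg h
    have hg : Real.log (1 + |t|) ≤ Real.log 2 + Real.log |t| := by
      rw [← Real.log_mul (by norm_num) ht0.ne']
      exact Real.log_le_log (by positivity) (by linarith)
    rw [max_eq_left (by linarith : -Real.log |t| ≤ 0)]
    refine max_le ?_ ?_ <;> nlinarith
  · have hl := Real.log_nonpos ht0.le h
    have hg : Real.log (1 + |t|) ≤ Real.log 2 :=
      Real.log_le_log (by positivity) (by linarith)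
    rw [max_eq_right (by linarith : 0 ≤ -Real.log |t|)]
    refine max_le ?_ ?_ <;> nlinarith

/-- The logarithm of the symmetric majorant of the integrand. -/
noncomputable def totalEdge (a b : ℝ) (x : ι → ℝ) : ℝ :=
  ∑ j, logEdge a b (x j) + ∑ j, logEdge a b (1 - x j)
    + ∑ p ∈ univ.filter (fun p : ι × ι => p.1 < p.2), logEdge a b (x p.1 - x p.2)

@[fun_prop]
theorem measurable_totalEdge (a b : ℝ) : Measurable (totalEdge (ι := ι) a b) := by
  unfold totalEdge; fun_prop

theorem exists_totalEdge_le {a b : ℝ} (ha : 0 ≤ a) (hab : a ≤ b) :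
    ∃ C, ∀ x : ι → ℝ, totalEdge a b x ≤ C + b * totalPole x - a * totalGrowth x := by
  refine ⟨∑ _i : ι, (b * Real.log 2 + 3 * (a * Real.log 2))
    + ∑ _p ∈ univ.filter (fun p : ι × ι => p.1 < p.2), a * Real.log 2, fun x => ?_⟩
  have hroot : ∀ i, logEdge a b (x i) + logEdge a b (1 - x i)
      ≤ (b * Real.log 2 + 3 * (a * Real.log 2)) + b * rootPole (x i)
        - a * (2 * logGrowth (x i)) := by
    intro i
    have h1 := logEdge_le ha hab (x i)
    have h2 := logEdge_le ha hab (1 - x i)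
    have h3 := mul_le_mul_of_nonneg_left (logPole_add_le_rootPole (x i)) (ha.trans hab)
    have h4 : logGrowth (x i) ≤ logGrowth (1 - x i) + Real.log 2 := by
      have := logGrowth_le_add_log (s := x i) (t := x i - 1) zero_le_one (by simp)
      rwa [← logGrowth_neg (x i - 1), neg_sub, one_add_one_eq_two] at this
    have h5 := mul_le_mul_of_nonneg_left h4 ha
    linarith
  have h1 := Finset.sum_le_sum fun i (_ : i ∈ univ) => hroot i
  have h2 := Finset.sum_le_sum fun p (_ : p ∈ univ.filter (fun p : ι × ι => p.1 < p.2)) =>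
    logEdge_le ha hab (x p.1 - x p.2)
  simp only [Finset.sum_add_distrib, Finset.sum_sub_distrib, ← Finset.mul_sum] at h1 h2
  simp only [totalEdge, totalPole, totalGrowth, Finset.sum_add_distrib, ← Finset.mul_sum]
  linarith

theorem exists_totalGrowth_le :
    ∃ D, ∀ x y : ι → ℝ, (∀ i, |x i - y i| ≤ 1) → totalGrowth x ≤ totalGrowth y + D := by
  refine ⟨2 * ∑ _i : ι, Real.log (1 + 2)
    + ∑ _p ∈ univ.filter (fun p : ι × ι => p.1 < p.2), Real.log (1 + 2), fun x y h => ?_⟩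
  have h1 := Finset.sum_le_sum fun i (_ : i ∈ univ) =>
    logGrowth_le_add_log zero_le_two ((h i).trans one_le_two)
  have h2 := Finset.sum_le_sum fun p (_ : p ∈ univ.filter (fun p : ι × ι => p.1 < p.2)) =>
    logGrowth_le_add_log (s := x p.1 - x p.2) (t := y p.1 - y p.2) zero_le_two (by
      have h1 := abs_le.1 (h p.1)
      have h2 := abs_le.1 (h p.2)
      exact abs_le.2 ⟨by linarith, by linarith⟩)
  rw [Finset.sum_add_distrib] at h1 h2
  simp only [totalGrowth]
  linarith

theorem one_le_lintegral_prod_unitCutoff (y : ι → ℝ) :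
    1 ≤ ∫⁻ x : ι → ℝ, ∏ i, unitCutoff (x i) (y i) := by
  have h : ∀ x : ι → ℝ, ∏ i, unitCutoff (x i) (y i) = (Metric.closedBall y 1).indicator 1 x := by
    intro x
    by_cases hx : x ∈ Metric.closedBall y 1
    · rw [Set.indicator_of_mem hx]
      refine Finset.prod_eq_one fun i _ => if_pos ?_
      rw [← Real.dist_eq]
      exact (dist_le_pi_dist x y i).trans hx
    · rw [Set.indicator_of_notMem hx]
      rw [Metric.mem_closedBall, dist_pi_le_iff zero_le_one] at hx
      push Not at hx
      obtain ⟨i, hi⟩ := hx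
      exact Finset.prod_eq_zero (mem_univ i) (if_neg (by rw [← Real.dist_eq]; exact hi.not_ge))
  simp only [h]
  rw [lintegral_indicator_one Metric.isClosed_closedBall.measurableSet,
    Real.volume_pi_closedBall _ zero_le_one, ENNReal.one_le_ofReal]
  exact one_le_pow₀ (by norm_num)

/-- The symmetric majorant is integrable: poles are averaged at unit scale, which leaves the
growth factor essentially unchanged. -/
theorem integrable_exp_totalEdge {a b : ℝ} (hab : a ≤ b)
    (ha : 2 / ((Fintype.card ι : ℝ) + 3) < a) (hb : b < 2 / ((Fintype.card ι : ℝ) + 1)) :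
    Integrable fun x : ι → ℝ => Real.exp (totalEdge a b x) := by
  have ha0 : 0 ≤ a := le_trans (by positivity) ha.le
  refine ⟨(by fun_prop : Measurable _).aestronglyMeasurable, ?_⟩
  rw [hasFiniteIntegral_iff_ofReal (Filter.Eventually.of_forall fun _ => (Real.exp_pos _).le)]
  obtain ⟨C, hC⟩ := exists_totalEdge_le (ι := ι) ha0 hab
  obtain ⟨D, hD⟩ := exists_totalGrowth_le (ι := ι)
  obtain ⟨J, hJ, hJle⟩ := exists_lintegral_totalPole_le (ι := ι) (ha0.trans hab) hb
  set W : (ι → ℝ) → ℝ≥0∞ := fun x => ENNReal.ofReal (Real.exp (-a * totalGrowth x))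
  set Z : (ι → ℝ) → ℝ≥0∞ := fun y => ENNReal.ofReal (Real.exp (b * totalPole y))
  set K : ℝ≥0∞ := ENNReal.ofReal (Real.exp (C + a * D))
  have hW : ∫⁻ x, W x < ∞ := lintegral_totalGrowth_lt_top ha
  have hWm : Measurable W := by fun_prop
  have hZm : Measurable Z := by fun_prop
  have hχ : Measurable fun z : (ι → ℝ) × (ι → ℝ) => ∏ i, unitCutoff (z.1 i) (z.2 i) :=
    Finset.measurable_prod _ fun i _ => measurable_unitCutoff.comp
      (f := fun z : (ι → ℝ) × (ι → ℝ) => (z.1 i, z.2 i)) (by fun_prop)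
  have hχl : ∀ y : ι → ℝ, Measurable fun x : ι → ℝ => ∏ i, unitCutoff (x i) (y i) :=
    fun _ => hχ.comp (measurable_id.prodMk measurable_const)
  have hχr : ∀ x : ι → ℝ, Measurable fun y : ι → ℝ => ∏ i, unitCutoff (x i) (y i) :=
    fun _ => hχ.comp (measurable_const.prodMk measurable_id)
  have hpt : ∀ x y : ι → ℝ,
      (∏ i, unitCutoff (x i) (y i)) * ENNReal.ofReal (Real.exp (totalEdge a b y))
      ≤ (K * W x) * ((∏ i, unitCutoff (x i) (y i)) * Z y) := by
    intro x y
    by_cases h : ∀ i, |x i - y i| ≤ 1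
    · have h1 : ∏ i, unitCutoff (x i) (y i) = 1 := Finset.prod_eq_one fun i _ => if_pos (h i)
      rw [h1, one_mul, one_mul, ← ENNReal.ofReal_mul (Real.exp_pos _).le,
        ← ENNReal.ofReal_mul (by positivity), ← Real.exp_add, ← Real.exp_add]
      refine ENNReal.ofReal_le_ofReal (Real.exp_le_exp.2 ?_)
      have := mul_le_mul_of_nonneg_left (hD x y h) ha0
      linarith [hC y]
    · push Not at h
      obtain ⟨i, hi⟩ := h
      have h0 : ∏ i, unitCutoff (x i) (y i) = 0 :=
        Finset.prod_eq_zero (mem_univ i) (if_neg hi.not_ge)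
      simp [h0]
  calc ∫⁻ y : ι → ℝ, ENNReal.ofReal (Real.exp (totalEdge a b y))
      ≤ ∫⁻ y : ι → ℝ, ∫⁻ x : ι → ℝ,
          (∏ i, unitCutoff (x i) (y i)) * ENNReal.ofReal (Real.exp (totalEdge a b y)) := by
        refine lintegral_mono fun y => ?_
        rw [lintegral_mul_const _ (hχl y)]
        exact le_mul_of_one_le_left zero_le (one_le_lintegral_prod_unitCutoff y)
    _ ≤ ∫⁻ y : ι → ℝ, ∫⁻ x : ι → ℝ, (K * W x) * ((∏ i, unitCutoff (x i) (y i)) * Z y) :=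
        lintegral_mono fun y => lintegral_mono fun x => hpt x y
    _ = ∫⁻ x : ι → ℝ, ∫⁻ y : ι → ℝ, (K * W x) * ((∏ i, unitCutoff (x i) (y i)) * Z y) := by
        refine lintegral_lintegral_swap (Measurable.aemeasurable ?_)
        exact ((hWm.comp measurable_snd).const_mul K).mul
          ((hχ.comp measurable_swap).mul (hZm.comp measurable_fst))
    _ ≤ ∫⁻ x : ι → ℝ, (K * W x) * J := by
        refine lintegral_mono fun x => ?_
        rw [lintegral_const_mul (K * W x) (f := fun y => (∏ i, unitCutoff (x i) (y i)) * Z y)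
          ((hχr x).mul hZm)]
        gcongr
        exact hJle x
    _ = K * (∫⁻ x, W x) * J := by
        rw [lintegral_mul_const _ (hWm.const_mul K), lintegral_const_mul _ hWm]
    _ < ∞ := by finiteness

end Majorant

/-- Integrals of exponentials of linear forms depend holomorphically on the form's parameter as
long as there is room for an arbitrarily small loss in each coefficient. -/
theorem integrable_and_differentiableAt_integral_cexp {E X K : Type*} [NormedAddCommGroup E]
    [NormedSpace ℂ E] [MeasurableSpace X] {μ : Measure X} (T : Finset K) (π : K → E →L[ℂ] ℂ)
    (hπ : ∀ e, ‖π e‖ ≤ 1) (d : K → X → ℝ) (hd : ∀ e, Measurable (d e)) (s₀ : E) {δ : ℝ}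
    (hδ : 0 < δ)
    (hint : Integrable (fun x => Real.exp (∑ e ∈ T, ((π e s₀).re * d e x + 2 * δ * |d e x|))) μ) :
    Integrable (fun x => Complex.exp (∑ e ∈ T, (d e x : ℂ) * π e s₀)) μ ∧
      DifferentiableAt ℂ (fun s => ∫ x, Complex.exp (∑ e ∈ T, (d e x : ℂ) * π e s) ∂μ) s₀ := by
  set form : X → E →L[ℂ] ℂ := fun x => ∑ e ∈ T, (d e x : ℂ) • π e with hform
  set total : X → ℝ := fun x => ∑ e ∈ T, |d e x| with htotal
  have happ : ∀ x s, form x s = ∑ e ∈ T, (d e x : ℂ) * π e s := fun x s => by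
    simp [hform]
  have htotal0 : ∀ x, 0 ≤ total x := fun x => Finset.sum_nonneg fun _ _ => abs_nonneg _
  have hnorm : ∀ x, ‖form x‖ ≤ total x := fun x => by
    refine (norm_sum_le _ _).trans (Finset.sum_le_sum fun e _ => ?_)
    rw [norm_smul, Complex.norm_real, Real.norm_eq_abs]
    exact mul_le_of_le_one_right (abs_nonneg _) (hπ e)
  have hre : ∀ x s, (form x s).re ≤ (form x s₀).re + ‖s - s₀‖ * total x := fun x s => by
    have h1 := ((form x) (s - s₀)).re_le_norm.trans ((form x).le_opNorm (s - s₀))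
    rw [map_sub, Complex.sub_re] at h1
    nlinarith [hnorm x, norm_nonneg (s - s₀)]
  have hexp : ∀ x, ∑ e ∈ T, ((π e s₀).re * d e x + 2 * δ * |d e x|)
      = (form x s₀).re + 2 * δ * total x := fun x => by
    rw [Finset.sum_add_distrib, ← Finset.mul_sum, happ, Complex.re_sum, htotal]
    simp [mul_comm]
  simp only [hexp] at hint
  simp only [← happ]
  have hmeas_form : StronglyMeasurable form :=
    Finset.stronglyMeasurable_fun_sum _ fun e _ =>
      (Complex.measurable_ofReal.comp (hd e)).stronglyMeasurable.smul_const _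
  have hmeas : ∀ s, StronglyMeasurable fun x => Complex.exp (form x s) := fun s =>
    Complex.continuous_exp.comp_stronglyMeasurable ((ContinuousLinearMap.apply ℂ ℂ s).continuous.comp_stronglyMeasurable hmeas_form)
  have hI : Integrable (fun x => Complex.exp (form x s₀)) μ := by
    refine hint.mono' (hmeas s₀).aestronglyMeasurable (Filter.Eventually.of_forall fun x => ?_)
    rw [Complex.norm_exp]
    exact Real.exp_le_exp.2 (by nlinarith [mul_nonneg hδ.le (htotal0 x)])
  refine ⟨hI, (hasFDerivAt_integral_of_dominated_of_fderiv_le (𝕜 := ℂ)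
    (F' := fun s x => Complex.exp (form x s) • form x)
    (bound := fun x => δ⁻¹ * Real.exp ((form x s₀).re + 2 * δ * total x))
    (Metric.ball_mem_nhds s₀ hδ)
    (Filter.Eventually.of_forall fun s => (hmeas s).aestronglyMeasurable) hI
    ((hmeas s₀).smul hmeas_form).aestronglyMeasurable
    (Filter.Eventually.of_forall fun x s hs => ?_) (hint.const_mul _)
    (Filter.Eventually.of_forall fun x s _ => (form x).hasFDerivAt.cexp)).differentiableAt⟩
  rw [Metric.mem_ball, dist_eq_norm] at hs
  rw [norm_smul, Complex.norm_exp]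
  have h1 : Real.exp (form x s).re ≤ Real.exp ((form x s₀).re + δ * total x) :=
    Real.exp_le_exp.2 ((hre x s).trans (by nlinarith [htotal0 x]))
  have h2 : total x ≤ δ⁻¹ * Real.exp (δ * total x) := by
    rw [inv_mul_eq_div, le_div_iff₀ hδ]
    linarith [Real.add_one_le_exp (δ * total x)]
  calc Real.exp (form x s).re * ‖form x‖
      ≤ Real.exp ((form x s₀).re + δ * total x) * (δ⁻¹ * Real.exp (δ * total x)) :=
        mul_le_mul h1 ((hnorm x).trans h2) (norm_nonneg _) (Real.exp_pos _).le
    _ = δ⁻¹ * Real.exp ((form x s₀).re + 2 * δ * total x) := by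
        rw [mul_left_comm, ← Real.exp_add]; ring_nf

theorem ae_ne_of_ne {ι : Type*} [Fintype ι] {i j : ι} (hij : i ≠ j) :
    ∀ᵐ x : ι → ℝ, x i ≠ x j := by
  classical
  set S : Submodule ℝ (ι → ℝ) := LinearMap.ker
    (LinearMap.proj (R := ℝ) (φ := fun _ : ι => ℝ) i - LinearMap.proj (φ := fun _ : ι => ℝ) j)
  have hS : S ≠ ⊤ := fun h => by
    have : (Pi.single i 1 : ι → ℝ) ∈ S := h ▸ Submodule.mem_top
    simp [S, hij] at this
  have := Measure.addHaar_submodule (volume : Measure (ι → ℝ)) S hS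
  refine measure_mono_null (fun x hx => ?_) this
  simpa [S, sub_eq_zero] using hx

section Edges

variable {ι : Type*}

/-- The exponent attached to an edge, as a linear form in the list of all exponents. -/
noncomputable def edgeExponent :
    ι ⊕ ι ⊕ (ι × ι) → ((ι → ℂ) × (ι → ℂ) × (ι → ι → ℂ)) →L[ℂ] ℂ
  | .inl j => (ContinuousLinearMap.proj j).comp (ContinuousLinearMap.fst ℂ _ _)
  | .inr (.inl j) => (ContinuousLinearMap.proj j).comp
      ((ContinuousLinearMap.fst ℂ _ _).comp (ContinuousLinearMap.snd ℂ _ _))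
  | .inr (.inr p) => (ContinuousLinearMap.proj p.2).comp
      ((ContinuousLinearMap.proj (φ := fun _ : ι => ι → ℂ) p.1).comp
        ((ContinuousLinearMap.snd ℂ _ _).comp (ContinuousLinearMap.snd ℂ _ _)))

/-- The signed length of an edge. -/
def edgeLength : ι ⊕ ι ⊕ (ι × ι) → (ι → ℝ) → ℝ
  | .inl j, x => x j
  | .inr (.inl j), x => 1 - x j
  | .inr (.inr p), x => x p.1 - x p.2

theorem measurable_edgeLength (e : ι ⊕ ι ⊕ (ι × ι)) : Measurable (edgeLength e) := by
  rcases e with j | j | p <;> unfold edgeLength <;> fun_prop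

theorem norm_edgeExponent_le [Fintype ι] (e : ι ⊕ ι ⊕ (ι × ι)) : ‖edgeExponent e‖ ≤ 1 := by
  refine ContinuousLinearMap.opNorm_le_bound _ zero_le_one fun s => ?_
  rw [one_mul]
  rcases e with j | j | p
  · exact (norm_le_pi_norm s.1 j).trans (norm_fst_le s)
  · exact ((norm_le_pi_norm s.2.1 j).trans (norm_fst_le s.2)).trans (norm_snd_le s)
  · exact (((norm_le_pi_norm (s.2.2 p.1) p.2).trans (norm_le_pi_norm s.2.2 p.1)).trans
      (norm_snd_le s.2)).trans (norm_snd_le s)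

variable [Fintype ι] [LinearOrder ι]

/-- The pairs of points carrying an exponent: `0` and `x j`, `1` and `x j`, `x i` and `x j`. -/
def edges (ι : Type*) [Fintype ι] [LinearOrder ι] : Finset (ι ⊕ ι ⊕ (ι × ι)) :=
  univ.disjSum (univ.disjSum (univ.filter fun p : ι × ι => p.1 < p.2))

theorem sum_edges {M : Type*} [AddCommMonoid M] (f : ι ⊕ ι ⊕ (ι × ι) → M) :
    ∑ e ∈ edges ι, f e = ∑ j, f (.inl j) + (∑ j, f (.inr (.inl j))
      + ∑ p ∈ univ.filter (fun p : ι × ι => p.1 < p.2), f (.inr (.inr p))) := by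
  simp [edges, Finset.sum_disjSum]

theorem ae_edgeLength_ne_zero :
    ∀ᵐ x : ι → ℝ, ∀ e ∈ edges ι, edgeLength e x ≠ 0 := by
  refine (ae_ball_iff (edges ι).countable_toSet).2 ?_
  rintro (j | j | p) he
  · exact Measure.ae_eval_ne _ j 0
  · filter_upwards [Measure.ae_eval_ne (fun _ : ι => (volume : Measure ℝ)) j 1] with x hx
    exact sub_ne_zero.2 (Ne.symm hx)
  · have hp : p.1 < p.2 := by simpa [edges] using he
    filter_upwards [ae_ne_of_ne hp.ne] with x hx
    exact sub_ne_zero.2 hx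

end Edges

theorem ofReal_abs_cpow {t : ℝ} (ht : t ≠ 0) (z : ℂ) :
    ((|t| : ℝ) : ℂ) ^ z = Complex.exp ((Real.log t : ℂ) * z) := by
  rw [Complex.cpow_def_of_ne_zero (by simpa using ht), ← Complex.ofReal_log (abs_nonneg t),
    Real.log_abs]

theorem ae_KNintegrand_eq_cexp (N : ℕ) :
    ∀ᵐ x : Fin (N - 3) → ℝ, ∀ s, KNintegrand N s.1 s.2.1 s.2.2 x
      = Complex.exp (∑ e ∈ edges (Fin (N - 3)),
          (Real.log (edgeLength e x) : ℂ) * edgeExponent e s) := by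
  filter_upwards [ae_edgeLength_ne_zero] with x hx s
  rw [sum_edges, Complex.exp_add, Complex.exp_add, Complex.exp_sum, Complex.exp_sum,
    Complex.exp_sum, KNintegrand, mul_assoc]
  congr 1
  · exact Finset.prod_congr rfl fun j _ => ofReal_abs_cpow (hx (.inl j) (by simp [edges])) _
  congr 1
  · exact Finset.prod_congr rfl fun j _ => ofReal_abs_cpow (hx (.inr (.inl j)) (by simp [edges])) _
  · exact Finset.prod_congr rfl fun p hp =>
      ofReal_abs_cpow (hx (.inr (.inr p)) (by simpa [edges] using hp)) _

theorem mul_add_abs_le_logEdge {a b r δ t : ℝ} (ha : r + 2 * δ ≤ -a) (hb : -b ≤ r - 2 * δ) :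
    r * Real.log t + 2 * δ * |Real.log t| ≤ logEdge a b t := by
  rcases le_total 0 (Real.log t) with h | h
  · refine le_max_of_le_left ?_
    rw [abs_of_nonneg h]
    nlinarith
  · refine le_max_of_le_right ?_
    rw [abs_of_nonpos h]
    nlinarith

theorem KNregion_edgeExponent {N : ℕ} {lo hi : ℝ}
    {s : (Fin (N - 3) → ℂ) × (Fin (N - 3) → ℂ) × (Fin (N - 3) → Fin (N - 3) → ℂ)}
    (hs : s ∈ KNregion N lo hi) :
    ∀ e ∈ edges (Fin (N - 3)), lo < (edgeExponent e s).re ∧ (edgeExponent e s).re < hi := by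
  rintro (j | j | p) he
  · exact hs.1 j
  · exact hs.2.1 j
  · exact hs.2.2 p.1 p.2 (by simpa [edges] using he)

theorem exists_uniform_gap {K : Type*} (T : Finset K) (f : K → ℝ) {lo hi : ℝ}
    (h : ∀ e ∈ T, lo < f e ∧ f e < hi) :
    ∃ δ > 0, ∀ e ∈ T, lo + 3 * δ < f e ∧ f e < hi - 3 * δ := by
  have key : ∀ᶠ δ in nhdsWithin (0 : ℝ) (Set.Ioi 0),
      ∀ e ∈ T, lo + 3 * δ < f e ∧ f e < hi - 3 * δ := by
    refine (Filter.eventually_all_finset T).2 fun e he => ?_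
    refine Filter.Eventually.filter_mono nhdsWithin_le_nhds (Filter.Eventually.and ?_ ?_)
    · exact ContinuousAt.eventually_lt (by fun_prop) continuousAt_const (by simpa using (h e he).1)
    · exact ContinuousAt.eventually_lt continuousAt_const (by fun_prop) (by simpa using (h e he).2)
  obtain ⟨δ, hδ, hδ0⟩ := (key.and self_mem_nhdsWithin).exists
  exact ⟨δ, hδ0, hδ⟩

theorem exists_integrable_exp_edges (N : ℕ) (hN : 4 ≤ N)
    {s : (Fin (N - 3) → ℂ) × (Fin (N - 3) → ℂ) × (Fin (N - 3) → Fin (N - 3) → ℂ)}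
    (hs : s ∈ KNregion N (-2 / ((N : ℝ) - 2)) (-2 / (N : ℝ))) :
    ∃ δ > 0, Integrable fun x : Fin (N - 3) → ℝ => Real.exp (∑ e ∈ edges (Fin (N - 3)),
      ((edgeExponent e s).re * Real.log (edgeLength e x)
        + 2 * δ * |Real.log (edgeLength e x)|)) := by
  obtain ⟨δ, hδ, h⟩ := exists_uniform_gap _ (fun e => (edgeExponent e s).re)
    (KNregion_edgeExponent hs)
  refine ⟨δ, hδ, ?_⟩
  have hcard : ((Fintype.card (Fin (N - 3)) : ℕ) : ℝ) = N - 3 := by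
    rw [Fintype.card_fin, Nat.cast_sub (by omega)]; norm_num
  have h0 := h (.inl ⟨0, by omega⟩) (by simp [edges])
  have hint := integrable_exp_totalEdge (ι := Fin (N - 3)) (a := 2 / N + δ) (b := 2 / (N - 2) - δ)
    (by rw [neg_div, neg_div] at h0; linarith [h0.1, h0.2])
    (by rw [hcard, sub_add_cancel]; linarith)
    (by rw [hcard, show (N : ℝ) - 3 + 1 = N - 2 by ring]; linarith)
  refine hint.mono' (Measurable.aestronglyMeasurable ?_) (Filter.Eventually.of_forall fun x => ?_)
  · have := measurable_edgeLength (ι := Fin (N - 3))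
    fun_prop
  · rw [Real.norm_of_nonneg (Real.exp_pos _).le, Real.exp_le_exp]
    refine (Finset.sum_le_sum (g := fun e => logEdge (2 / N + δ) (2 / (N - 2) - δ)
      (edgeLength e x)) fun e he => ?_).trans_eq ?_
    · have := h e he
      rw [neg_div, neg_div] at this
      exact mul_add_abs_le_logEdge (by linarith [this.2]) (by linarith [this.1])
    · rw [sum_edges, totalEdge, add_assoc]
      rfl

/-- For `N ≥ 4`, the real Koba-Nielsen local zeta function converges (the integrand is
absolutely integrable over `ℝ^{N-3}`) and is holomorphic in `s` on the open set where
`-2/(N-2) < Re(s_{ij}) < -2/N` for every index pair `ij`. -/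
theorem kobaNielsen_real_convergent_and_holomorphic (N : ℕ) (hN : 4 ≤ N) :
    (∀ s ∈ KNregion N (-2 / ((N : ℝ) - 2)) (-2 / (N : ℝ)),
      Integrable (KNintegrand N s.1 s.2.1 s.2.2)) ∧
    DifferentiableOn ℂ
      (fun s : (Fin (N - 3) → ℂ) × (Fin (N - 3) → ℂ) × (Fin (N - 3) → Fin (N - 3) → ℂ) =>
        ∫ x, KNintegrand N s.1 s.2.1 s.2.2 x)
      (KNregion N (-2 / ((N : ℝ) - 2)) (-2 / (N : ℝ))) := by
  have hmain := fun s hs =>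
    let ⟨_, hδ, hint⟩ := exists_integrable_exp_edges N hN (s := s) hs
    integrable_and_differentiableAt_integral_cexp (edges (Fin (N - 3))) edgeExponent
      norm_edgeExponent_le (fun e x => Real.log (edgeLength e x))
      (fun e => Real.measurable_log.comp (measurable_edgeLength e)) s hδ hint
  have hae := ae_KNintegrand_eq_cexp N
  refine ⟨fun s hs => (hmain s hs).1.congr (hae.mono fun x hx => (hx s).symm), fun s hs => ?_⟩
  refine DifferentiableAt.differentiableWithinAt ?_
  refine (hmain s hs).2.congr_of_eventuallyEq (Filter.Eventually.of_forall fun s => ?_)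
  exact integral_congr_ae (hae.mono fun x hx => hx s)
end

section
/- Let N ≥ 4 be an integer. The real Koba-Nielsen local zeta function Z^(N)(s) converges and is holomorphic on the region of s = (s_{ij}) ∈ ℂ^{N(N-3)/2} determined by the following 2^{N-1} − N − 1 inequalities: (A) Re(s_{ij}) > −1 for all index pairs ij; (B) for every subset J ⊆ {2,…,N−2} with #J ≥ 2: ∑_{j∈J} Re(s_{1j}) + ∑_{i,j∈J, i<j} Re(s_{ij}) > −#J; (C) for every subset J ⊆ {2,…,N−2} with #J ≥ 2: ∑_{j∈J} Re(s_{(N−1)j}) + ∑_{i,j∈J, i<j} Re(s_{ij}) > −#J; (D) for every subset J ⊆ {2,…,N−2} with #J ≥ 3: ∑_{i,j∈J, i<j} Re(s_{ij}) > −#J + 1; (E) for every nonempty subset J ⊆ {2,…,N−2}: ∑_{j∈J} Re(s_{1j}) + ∑_{j∈J} Re(s_{(N−1)j}) + ∑_{i∈{2,…,N−2}∖J, j∈J} Re(s_{ij}) + ∑_{i,j∈J, i<j} Re(s_{ij}) < −#J. -/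
open MeasureTheory Finset

/-- The convergence region of `Z^(N)(s)` described by the `2^{N-1} - N - 1` inequalities
(A)–(E) of Proposition `exact convergence domain`. Subsets `J ⊆ {2,…,N-2}` are modelled
as `J : Finset (Fin (N-3))`; for `i > j` the symbol `s_{ij}` means `s_{ji}`. -/
def KNregionExact (N : ℕ) :
    Set ((Fin (N - 3) → ℂ) × (Fin (N - 3) → ℂ) × (Fin (N - 3) → Fin (N - 3) → ℂ)) :=
  {s |
    -- (A)
    ((∀ j, -1 < (s.1 j).re) ∧ (∀ j, -1 < (s.2.1 j).re) ∧
      (∀ i j, i < j → -1 < (s.2.2 i j).re)) ∧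
    -- (B)
    (∀ J : Finset (Fin (N - 3)), 2 ≤ J.card →
      -(J.card : ℝ) <
        (∑ j ∈ J, (s.1 j).re) +
          ∑ p ∈ (J ×ˢ J).filter (fun p => p.1 < p.2), (s.2.2 p.1 p.2).re) ∧
    -- (C)
    (∀ J : Finset (Fin (N - 3)), 2 ≤ J.card →
      -(J.card : ℝ) <
        (∑ j ∈ J, (s.2.1 j).re) +
          ∑ p ∈ (J ×ˢ J).filter (fun p => p.1 < p.2), (s.2.2 p.1 p.2).re) ∧
    -- (D)
    (∀ J : Finset (Fin (N - 3)), 3 ≤ J.card →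
      -(J.card : ℝ) + 1 <
        ∑ p ∈ (J ×ˢ J).filter (fun p => p.1 < p.2), (s.2.2 p.1 p.2).re) ∧
    -- (E)
    (∀ J : Finset (Fin (N - 3)), J.Nonempty →
      (∑ j ∈ J, (s.1 j).re) + (∑ j ∈ J, (s.2.1 j).re) +
          (∑ i ∈ Jᶜ, ∑ j ∈ J, (if i < j then (s.2.2 i j).re else (s.2.2 j i).re)) +
          (∑ p ∈ (J ×ˢ J).filter (fun p => p.1 < p.2), (s.2.2 p.1 p.2).re) <
        -(J.card : ℝ))}

theorem sum_mul_max_nonpos {ι : Type*} [Fintype ι] (c v : ι → ℝ)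
    (h : ∀ θ : ℝ, 0 ≤ θ → ∑ i, (if θ < v i then c i else 0) ≤ 0) :
    ∑ i, c i * max (v i) 0 ≤ 0 := by
  have key : ∀ i, IntegrableOn (fun θ : ℝ => if θ < v i then c i else 0) (Set.Ioi 0) ∧
      ∫ θ in Set.Ioi (0 : ℝ), (if θ < v i then c i else 0) = c i * max (v i) 0 := by
    intro i
    have e : (fun θ : ℝ => if θ < v i then c i else 0) =
        (Set.Iio (v i)).indicator fun _ => c i := by
      ext θ; simp [Set.indicator]
    have e2 : Set.Iio (v i) ∩ Set.Ioi (0 : ℝ) = Set.Ioo 0 (v i) := by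
      ext; simp [and_comm]
    constructor
    · rw [e, IntegrableOn, integrable_indicator_iff measurableSet_Iio, IntegrableOn,
        Measure.restrict_restrict measurableSet_Iio, e2]
      exact integrableOn_const (by simp)
    · rw [e, integral_indicator measurableSet_Iio, Measure.restrict_restrict measurableSet_Iio, e2]
      simp [mul_comm]
  calc ∑ i, c i * max (v i) 0
      = ∑ i, ∫ θ in Set.Ioi (0 : ℝ), (if θ < v i then c i else 0) :=
        sum_congr rfl fun i _ => (key i).2.symm
    _ = ∫ θ in Set.Ioi (0 : ℝ), ∑ i, (if θ < v i then c i else 0) :=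
        (integral_finsetSum _ fun i _ => (key i).1).symm
    _ ≤ 0 := setIntegral_nonpos measurableSet_Ioi fun θ hθ => h θ (le_of_lt hθ)

theorem sum_mul_max_add_nonpos {ι κ : Type*} [Fintype ι] [Fintype κ] (c v : ι → ι → ℝ)
    (d w : κ → ℝ)
    (h : ∀ θ : ℝ, 0 ≤ θ → (∑ i, ∑ j, if θ < v i j then c i j else 0) +
      ∑ k, (if θ < w k then d k else 0) ≤ 0) :
    (∑ i, ∑ j, c i j * max (v i j) 0) + ∑ k, d k * max (w k) 0 ≤ 0 := by
  have := sum_mul_max_nonpos (ι := (ι × ι) ⊕ κ) (Sum.elim (fun p => c p.1 p.2) d)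
    (Sum.elim (fun p => v p.1 p.2) w) (by
      intro θ hθ
      rw [Fintype.sum_sum_type, Fintype.sum_prod_type]
      exact h θ hθ)
  rwa [Fintype.sum_sum_type, Fintype.sum_prod_type] at this

/-- The `k`-th gap (between `k` and `k + 1`) lies between the positions `i` and `j`. -/
def GapBetween {n : ℕ} (i j : Fin (n + 2)) (k : Fin (n + 1)) : Prop :=
  (i ≤ k.castSucc ∧ k.succ ≤ j) ∨ (j ≤ k.castSucc ∧ k.succ ≤ i)

theorem GapBetween.symm {n : ℕ} {i j : Fin (n + 2)} {k : Fin (n + 1)} (h : GapBetween i j k) :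
    GapBetween j i k := Or.symm h

/-- Two positions are in the same cluster when every gap between them belongs to `L`. -/
def SameCluster {n : ℕ} (L : Finset (Fin (n + 1))) (i j : Fin (n + 2)) : Prop :=
  ∀ k, GapBetween i j k → k ∈ L

/-- Each cluster has a representative, and there is one more cluster than gaps outside `L`. -/
theorem exists_clusterRep {n : ℕ} (L : Finset (Fin (n + 1))) :
    ∃ (R : Finset (Fin (n + 2))) (rep : Fin (n + 2) → Fin (n + 2)),
      R.card = Lᶜ.card + 1 ∧ (∀ i, rep i ∈ R) ∧ (∀ r ∈ R, rep r = r) ∧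
      ∀ i j, rep i = rep j ↔ SameCluster L i j := by
  classical
  let R : Finset (Fin (n + 2)) := insert 0 (Lᶜ.image Fin.succ)
  have h0 : ∀ i, (R.filter (· ≤ i)).Nonempty := fun i => ⟨0, by simp [R]⟩
  let rep : Fin (n + 2) → Fin (n + 2) := fun i => (R.filter (· ≤ i)).max' (h0 i)
  have hmem : ∀ i, rep i ∈ R ∧ rep i ≤ i := fun i =>
    Finset.mem_filter.1 ((R.filter (· ≤ i)).max'_mem (h0 i))
  have hmax : ∀ i, ∀ r ∈ R, r ≤ i → r ≤ rep i := fun i r hr hri =>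
    Finset.le_max' _ _ (by simp [hr, hri])
  have key : ∀ i j, i ≤ j → (rep i = rep j ↔ SameCluster L i j) := by
    intro i j hij
    constructor
    · intro h k hk
      by_contra hkL
      have hkR : k.succ ∈ R := by simp [R, hkL]
      have hk' : i ≤ k.castSucc ∧ k.succ ≤ j := by
        rcases hk with hk | ⟨h1, h2⟩
        · exact hk
        · exact absurd ((hij.trans h1).trans_lt Fin.castSucc_lt_succ) (not_lt.2 h2)
      have h1 := hmax j _ hkR hk'.2
      rw [← h] at h1
      exact absurd ((h1.trans (hmem i).2).trans hk'.1) (not_le.2 Fin.castSucc_lt_succ)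
    · intro h
      refine le_antisymm (hmax j _ (hmem i).1 ((hmem i).2.trans hij))
        (hmax i _ (hmem j).1 ?_)
      by_contra hlt
      rw [not_le] at hlt
      have hj := (hmem j).1
      simp only [R, Finset.mem_insert, Finset.mem_image, Finset.mem_compl] at hj
      rcases hj with hj | ⟨k, hk, hkj⟩
      · rw [hj] at hlt; exact absurd hlt (by simp)
      · refine hk (h k (Or.inl ⟨?_, hkj ▸ (hmem j).2⟩))
        rw [← hkj] at hlt
        exact Fin.le_castSucc_iff.2 hlt
  refine ⟨R, rep, ?_, fun i => (hmem i).1, fun r hr =>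
    le_antisymm (hmem r).2 (hmax r r hr le_rfl), fun i j => ?_⟩
  · rw [Finset.card_insert_of_notMem, Finset.card_image_of_injective _ (Fin.succ_injective _)]
    simp [Fin.succ_ne_zero]
  · rcases le_total i j with h | h
    · exact key i j h
    · rw [eq_comm, key j i h]
      exact ⟨fun H k hk => H k hk.symm, fun H k hk => H k hk.symm⟩

/-- The exponents `S` of the pairwise distances of `n + 2` points satisfy, with margin `ε`, the
convergence conditions relative to a normalisation of the distance between the points `a`, `b`:
subsets not containing both `a` and `b` have positive degree, and the complements of subsets
containing both have negative degree. -/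
structure AdmissibleExponents {n : ℕ} (ε : ℝ) (a b : Fin (n + 2))
    (S : Fin (n + 2) → Fin (n + 2) → ℝ) : Prop where
  diag : ∀ i, S i i = 0
  collide : ∀ B : Finset (Fin (n + 2)), B.Nonempty → ¬(a ∈ B ∧ b ∈ B) →
    ε * ((B.card : ℝ) - 1) ≤ (∑ i ∈ B, ∑ j ∈ B, S i j) + (B.card - 1)
  escape : ∀ B : Finset (Fin (n + 2)), a ∈ B → b ∈ B →
    (∑ i, ∑ j, S i j) - (∑ i ∈ B, ∑ j ∈ B, S i j) + (1 + ε) * ((n : ℝ) + 2 - B.card) ≤ 0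

open Classical in
theorem sum_sameCluster_eq {n : ℕ} (S : Fin (n + 2) → Fin (n + 2) → ℝ)
    {L : Finset (Fin (n + 1))} {R : Finset (Fin (n + 2))} {rep : Fin (n + 2) → Fin (n + 2)}
    (hmem : ∀ i, rep i ∈ R) (hiff : ∀ i j, rep i = rep j ↔ SameCluster L i j) :
    (∑ i, ∑ j, if SameCluster L i j then S i j else 0) =
      ∑ r ∈ R, ∑ i with rep i = r, ∑ j with rep j = r, S i j := by
  rw [← Finset.sum_fiberwise_of_maps_to (fun i _ => hmem i)]
  refine sum_congr rfl fun r _ => sum_congr rfl fun i hi => ?_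
  rw [Finset.sum_filter]
  refine sum_congr rfl fun j _ => ?_
  simp only [mem_filter, mem_univ, true_and] at hi
  simp only [← hiff, hi, eq_comm]

theorem sum_card_fiber_eq {n : ℕ} {R : Finset (Fin (n + 2))} {rep : Fin (n + 2) → Fin (n + 2)}
    (hmem : ∀ i, rep i ∈ R) :
    ((n : ℝ) + 2) = ∑ r ∈ R, ((univ.filter fun i => rep i = r).card : ℝ) := by
  have := Finset.card_eq_sum_card_fiberwise (s := univ) (t := R) (f := rep) (fun i _ => hmem i)
  rw [Finset.card_univ, Fintype.card_fin] at this
  exact_mod_cast this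

open Classical in
/-- If every cluster has positive degree, so does their union. -/
theorem le_sum_sameCluster {n : ℕ} {S : Fin (n + 2) → Fin (n + 2) → ℝ} {ε : ℝ}
    {a b : Fin (n + 2)} (hS : AdmissibleExponents ε a b S)
    (L : Finset (Fin (n + 1))) (hab : ¬ SameCluster L a b) :
    0 ≤ (∑ i, ∑ j, if SameCluster L i j then S i j else 0) + (1 - ε) * L.card := by
  obtain ⟨R, rep, hR, hmem, hrep, hiff⟩ := exists_clusterRep L
  have e1 := sum_sameCluster_eq S hmem hiff
  have e2 := sum_card_fiber_eq hmem
  have e3 : (R.card : ℝ) = n + 1 - L.card + 1 := by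
    have h := Finset.card_add_card_compl L
    rw [Fintype.card_fin] at h
    have h' : (L.card : ℝ) + Lᶜ.card = n + 1 := by exact_mod_cast h
    rw [hR]; push_cast; linarith
  have e4 := Finset.sum_le_sum fun r (hr : r ∈ R) =>
    hS.collide (univ.filter fun i => rep i = r) ⟨r, by simp [hrep r hr]⟩ (by
      simp only [mem_filter, mem_univ, true_and]
      rintro ⟨h1, h2⟩
      exact hab ((hiff _ _).1 (h1.trans h2.symm)))
  rw [← Finset.mul_sum, Finset.sum_add_distrib, Finset.sum_sub_distrib, ← e1, ← e2] at e4
  simp only [Finset.sum_const, nsmul_eq_mul, mul_one] at e4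
  rw [e3] at e4
  linarith

open Classical in
theorem sum_not_sameCluster_le {n : ℕ} {S : Fin (n + 2) → Fin (n + 2) → ℝ} {ε : ℝ} (hε : 0 ≤ ε)
    {a b : Fin (n + 2)} (hS : AdmissibleExponents ε a b S)
    (L : Finset (Fin (n + 1))) (hab : SameCluster L a b) :
    (∑ i, ∑ j, if SameCluster L i j then 0 else S i j) + (1 + ε) * Lᶜ.card ≤ 0 := by
  obtain ⟨R, rep, hR, hmem, hrep, hiff⟩ := exists_clusterRep L
  have e0 : (∑ i, ∑ j, if SameCluster L i j then 0 else S i j) = (∑ i, ∑ j, S i j) -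
      (∑ i, ∑ j, if SameCluster L i j then S i j else 0) := by
    simp only [← Finset.sum_sub_distrib]
    refine sum_congr rfl fun i _ => sum_congr rfl fun j _ => ?_
    split_ifs <;> simp
  have e1 := sum_sameCluster_eq S hmem hiff
  have e2 := sum_card_fiber_eq hmem
  have hra : rep a ∈ R := hmem a
  have e4 := Finset.sum_le_sum fun r (hr : r ∈ R.erase (rep a)) =>
    hS.collide (univ.filter fun i => rep i = r) ⟨r, by simp [hrep r (Finset.mem_of_mem_erase hr)]⟩ (by
      simp only [mem_filter, mem_univ, true_and]
      rintro ⟨h1, h2⟩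
      exact (Finset.ne_of_mem_erase hr) h1.symm)
  have e5 := hS.escape (univ.filter fun i => rep i = rep a) (by simp) (by
    simpa using ((hiff a b).2 hab).symm)
  have e6 : ((R.erase (rep a)).card : ℝ) = Lᶜ.card := by
    rw [Finset.card_erase_of_mem hra, hR]; simp
  rw [← Finset.mul_sum, Finset.sum_add_distrib, Finset.sum_sub_distrib] at e4
  simp only [Finset.sum_const, nsmul_eq_mul, mul_one] at e4
  rw [← Finset.add_sum_erase _ _ hra] at e1 e2
  have e7 : ((R.erase (rep a)).card : ℝ) ≤
      ∑ r ∈ R.erase (rep a), ((univ.filter fun i => rep i = r).card : ℝ) := by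
    rw [Finset.card_eq_sum_ones]
    push_cast
    refine Finset.sum_le_sum fun r hr => ?_
    exact_mod_cast Finset.card_pos.2 ⟨r, by simp [hrep r (Finset.mem_of_mem_erase hr)]⟩
  rw [e6] at e4 e7
  rw [e0, e1]
  nlinarith [mul_le_mul_of_nonneg_left e7 hε]

theorem sum_mul_add_sum_le_neg_abs {n : ℕ} {S : Fin (n + 2) → Fin (n + 2) → ℝ} {ε : ℝ}
    (hε : 0 ≤ ε) {a b : Fin (n + 2)} (hS : AdmissibleExponents ε a b S)
    (u : Fin (n + 1) → ℝ) (M : Fin (n + 2) → Fin (n + 2) → ℝ)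
    (hle : ∀ i j, i ≠ j → ∀ θ, M i j ≤ θ ↔ ∀ k, GapBetween i j k → u k ≤ θ)
    (hlt : ∀ i j, i ≠ j → ∀ θ, M i j < θ ↔ ∀ k, GapBetween i j k → u k < θ)
    {k₀ : Fin (n + 1)} (hk₀ : GapBetween a b k₀) (hu₀ : u k₀ = 0)
    (hu : ∀ k, GapBetween a b k → u k ≤ 0) :
    (∑ i, ∑ j, S i j * M i j) + ∑ k, u k ≤ -ε * ∑ k, |u k| := by
  classical
  have hP := sum_mul_max_add_nonpos S M (fun _ => 1 + ε) u (by
      intro θ hθ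
      have := sum_not_sameCluster_le hε hS (univ.filter fun k => u k ≤ θ)
        (fun k hk => by simpa using (hu k hk).trans hθ)
      refine le_of_eq_of_le ?_ this
      congr 1
      · refine sum_congr rfl fun i _ => sum_congr rfl fun j _ => ?_
        rcases eq_or_ne i j with rfl | hij
        · simp [hS.diag]
        · have : SameCluster (univ.filter fun k => u k ≤ θ) i j ↔ M i j ≤ θ := by
            simp [hle i j hij, SameCluster]
          by_cases h : M i j ≤ θ
          · simp [this.2 h, not_lt.2 h]
          · simp [mt this.1 h, not_le.1 h]
      · rw [← Finset.sum_filter, Finset.sum_const, nsmul_eq_mul, mul_comm]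
        congr 3
        ext k; simp)
  have hN := sum_mul_max_add_nonpos (fun i j => -S i j) (fun i j => -M i j)
    (fun _ => -(1 - ε)) (fun k => -u k) (by
      intro θ hθ
      have := le_sum_sameCluster hS (univ.filter fun k => u k < -θ)
        (fun h => by
          have := h k₀ hk₀
          simp [hu₀] at this
          linarith)
      refine le_of_eq_of_le ?_ (neg_nonpos.2 this)
      rw [neg_add, ← Finset.sum_neg_distrib]
      congr 1
      · refine sum_congr rfl fun i _ => ?_
        rw [← Finset.sum_neg_distrib]
        refine sum_congr rfl fun j _ => ?_
        rcases eq_or_ne i j with rfl | hij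
        · simp [hS.diag]
        · have : SameCluster (univ.filter fun k => u k < -θ) i j ↔ M i j < -θ := by
            simp [hlt i j hij, SameCluster]
          by_cases h : M i j < -θ
          · simp [this.2 h, lt_neg_of_lt_neg h]
          · simp only [mt this.1 h, if_false, neg_zero]
            rw [if_neg]
            exact fun h' => h (lt_neg_of_lt_neg h')
      · rw [← Finset.sum_filter, Finset.sum_const, nsmul_eq_mul, mul_comm, neg_mul]
        congr 4
        ext k; simp [lt_neg])
  have eM : ∀ i j, S i j * M i j = S i j * max (M i j) 0 + -S i j * max (-M i j) 0 := by
    intro i j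
    have := max_zero_sub_max_neg_zero_eq_self (M i j)
    calc _ = S i j * (max (M i j) 0 - max (-M i j) 0) := by rw [this]
      _ = _ := by ring
  have eu : ∀ k, u k + ε * |u k| = (1 + ε) * max (u k) 0 + -(1 - ε) * max (-u k) 0 := by
    intro k
    rcases le_total 0 (u k) with h | h
    · rw [max_eq_left h, max_eq_right (by linarith), abs_of_nonneg h]; ring
    · rw [max_eq_right h, max_eq_left (by linarith), abs_of_nonpos h]; ring
  have : (∑ i, ∑ j, S i j * M i j) + ∑ k, (u k + ε * |u k|) ≤ 0 := by
    simp only [eM, eu, Finset.sum_add_distrib] at hP hN ⊢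
    linarith
  rw [Finset.sum_add_distrib, ← Finset.mul_sum] at this
  linarith

theorem exists_gapBetween {n : ℕ} {i j : Fin (n + 2)} (h : i ≠ j) : ∃ k, GapBetween i j k := by
  rcases lt_or_gt_of_ne h with h | h
  · refine ⟨⟨i, by omega⟩, Or.inl ⟨le_rfl, ?_⟩⟩
    rw [Fin.le_def]; simpa using h
  · refine ⟨⟨j, by omega⟩, Or.inr ⟨le_rfl, ?_⟩⟩
    rw [Fin.le_def]; simpa using h

theorem exists_gapMax {n : ℕ} (u : Fin (n + 1) → ℝ) :
    ∃ M : Fin (n + 2) → Fin (n + 2) → ℝ, ∀ i j, i ≠ j →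
      (∀ θ, M i j ≤ θ ↔ ∀ k, GapBetween i j k → u k ≤ θ) ∧
      (∀ θ, M i j < θ ↔ ∀ k, GapBetween i j k → u k < θ) ∧
      ∃ k, GapBetween i j k ∧ u k = M i j := by
  classical
  have hne : ∀ i j : Fin (n + 2), i ≠ j → (univ.filter (GapBetween i j)).Nonempty := by
    intro i j h
    obtain ⟨k, hk⟩ := exists_gapBetween h
    exact ⟨k, by simpa using hk⟩
  refine ⟨fun i j => if h : i ≠ j then (univ.filter (GapBetween i j)).sup' (hne i j h) u else 0,
    fun i j h => ?_⟩
  simp only [dif_pos h]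
  refine ⟨fun θ => by simp [Finset.sup'_le_iff], fun θ => by simp [Finset.sup'_lt_iff], ?_⟩
  obtain ⟨k, hk, hk'⟩ := Finset.exists_mem_eq_sup' (hne i j h) u
  exact ⟨k, by simpa using hk, hk'.symm⟩

theorem sub_le_of_gap_le {n : ℕ} {q : Fin (n + 2) → ℝ} {T : ℝ} (i : Fin (n + 2))
    (j : Fin (n + 2)) (hij : i ≤ j)
    (h : ∀ k, i ≤ Fin.castSucc k → k.succ ≤ j → q k.succ - q k.castSucc ≤ T) :
    q j - q i ≤ ((j : ℕ) - (i : ℕ) : ℝ) * T := by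
  induction j using Fin.induction with
  | zero =>
    have : i = 0 := le_antisymm hij (Fin.zero_le _)
    subst this; simp
  | succ k ih =>
    rcases eq_or_lt_of_le hij with rfl | hlt
    · simp
    · have hik : i ≤ k.castSucc := Fin.le_castSucc_iff.2 hlt
      have h1 := ih hik fun k' h1 h2 => h k' h1 (h2.trans Fin.castSucc_lt_succ.le)
      have h2 := h k hik le_rfl
      simp only [Fin.val_succ, Fin.val_castSucc] at h1 ⊢
      push_cast
      linarith

theorem log_dist_bounds {n : ℕ} {q : Fin (n + 2) → ℝ} (hq : StrictMono q) {i j : Fin (n + 2)}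
    (hij : i ≠ j) {m : ℝ}
    (hm : ∀ k, GapBetween i j k → Real.log (q k.succ - q k.castSucc) ≤ m)
    (hm' : ∃ k, GapBetween i j k ∧ Real.log (q k.succ - q k.castSucc) = m) :
    m ≤ Real.log |q i - q j| ∧ Real.log |q i - q j| ≤ m + Real.log (n + 2) := by
  wlog hlt : i < j generalizing i j
  · have := this hij.symm (fun k hk => hm k hk.symm) (hm'.imp fun k hk => ⟨hk.1.symm, hk.2⟩)
      (lt_of_le_of_ne (not_lt.1 hlt) hij.symm)
    rwa [abs_sub_comm] at this
  have hpos : 0 < q j - q i := sub_pos.2 (hq hlt)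
  have hgap : ∀ k : Fin (n + 1), 0 < q k.succ - q k.castSucc := fun k =>
    sub_pos.2 (hq Fin.castSucc_lt_succ)
  rw [abs_sub_comm, abs_of_pos hpos]
  constructor
  · obtain ⟨k, hk, rfl⟩ := hm'
    have hk' : i ≤ k.castSucc ∧ k.succ ≤ j := by
      rcases hk with hk | ⟨h1, h2⟩
      · exact hk
      · exact absurd ((hlt.le.trans h1).trans_lt Fin.castSucc_lt_succ) (not_lt.2 h2)
    exact Real.log_le_log (hgap k) (sub_le_sub (hq.monotone hk'.2) (hq.monotone hk'.1))
  · have h1 := sub_le_of_gap_le (q := q) (T := Real.exp m) i j hlt.le fun k h1 h2 =>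
      (Real.log_le_iff_le_exp (hgap k)).1 (hm k (Or.inl ⟨h1, h2⟩))
    have h2 : ((j : ℕ) - (i : ℕ) : ℝ) ≤ n + 2 := by
      have : ((j : ℕ) : ℝ) ≤ n + 2 := by exact_mod_cast j.2.le
      have : (0 : ℝ) ≤ ((i : ℕ) : ℝ) := by positivity
      linarith
    have h3 : q j - q i ≤ (n + 2) * Real.exp m :=
      h1.trans (mul_le_mul_of_nonneg_right h2 (Real.exp_pos _).le)
    calc Real.log (q j - q i) ≤ Real.log ((n + 2) * Real.exp m) := Real.log_le_log hpos h3
      _ = m + Real.log (n + 2) := by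
        rw [Real.log_mul (by positivity) (Real.exp_pos _).ne', Real.log_exp]; ring

theorem sum_log_dist_le_of_strictMono {n : ℕ} {S : Fin (n + 2) → Fin (n + 2) → ℝ} {ε A : ℝ}
    (hε : 0 ≤ ε) {a b : Fin (n + 2)} (hS : AdmissibleExponents ε a b S)
    (hA : ∀ i j, |S i j| ≤ A) {q : Fin (n + 2) → ℝ} (hq : StrictMono q)
    (hab : |q a - q b| = 1) :
    ∃ k₀, GapBetween a b k₀ ∧ ∑ i, ∑ j, S i j * Real.log |q i - q j| ≤
      (2 * (A * Real.log (n + 2) * (n + 2) ^ 2) + ε * Real.log (n + 2) * n) +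
      ∑ l : Fin n, (-Real.log (q (k₀.succAbove l).succ - q (k₀.succAbove l).castSucc) -
        ε * |Real.log (q (k₀.succAbove l).succ - q (k₀.succAbove l).castSucc)|) := by
  set u : Fin (n + 1) → ℝ := fun k => Real.log (q k.succ - q k.castSucc) with hu
  set D := Real.log (n + 2) with hD
  have hD0 : 0 ≤ D := Real.log_nonneg (by linarith [(Nat.cast_nonneg n : (0 : ℝ) ≤ n)])
  have hne : a ≠ b := by rintro rfl; simp at hab
  obtain ⟨M, hM⟩ := exists_gapMax u
  have hlog : ∀ i j, i ≠ j → M i j ≤ Real.log |q i - q j| ∧ Real.log |q i - q j| ≤ M i j + D :=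
    fun i j hij => log_dist_bounds hq hij (((hM i j hij).1 _).1 le_rfl) (hM i j hij).2.2
  obtain ⟨k₀, hk₀, hm⟩ := (hM a b hne).2.2
  set m := M a b with hm_def
  have hm0 : m ≤ 0 ∧ 0 ≤ m + D := by
    have := hlog a b hne
    rwa [hab, Real.log_one] at this
  refine ⟨k₀, hk₀, ?_⟩
  have key := sum_mul_add_sum_le_neg_abs hε hS (fun k => u k - m) (fun i j => M i j - m)
    (fun i j hij θ => by simpa only [sub_le_iff_le_add] using (hM i j hij).1 (θ + m))
    (fun i j hij θ => by simpa only [sub_lt_iff_lt_add] using (hM i j hij).2.1 (θ + m))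
    hk₀ (sub_eq_zero.2 hm) (fun k hk => sub_nonpos.2 (((hM a b hne).1 _).1 le_rfl k hk))
  have hterm : ∀ i j, S i j * Real.log |q i - q j| ≤ S i j * (M i j - m) + 2 * (A * D) := by
    intro i j
    have hA0 : 0 ≤ A := (abs_nonneg _).trans (hA i j)
    rcases eq_or_ne i j with rfl | hij
    · rw [hS.diag]; simp; positivity
    · have h := hlog i j hij
      have h1 : S i j * (Real.log |q i - q j| - (M i j - m)) ≤ A * (2 * D) := by
        refine (le_abs_self _).trans ?_
        rw [abs_mul]
        refine mul_le_mul (hA i j) ?_ (abs_nonneg _) hA0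
        rw [abs_le]; constructor <;> linarith
      linarith
  have h1 : ∑ i, ∑ j, S i j * Real.log |q i - q j| ≤
      (∑ i, ∑ j, S i j * (M i j - m)) + 2 * (A * D * (n + 2) ^ 2) := by
    refine (Finset.sum_le_sum fun i _ => Finset.sum_le_sum fun j _ => hterm i j).trans_eq ?_
    simp only [Finset.sum_add_distrib, Finset.sum_const, Finset.card_univ, Fintype.card_fin,
      nsmul_eq_mul]
    push_cast; ring
  rw [Fin.sum_univ_succAbove _ k₀, Fin.sum_univ_succAbove _ k₀, hm, sub_self, abs_zero, zero_add,
    zero_add] at key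
  have h2 : ∑ l : Fin n, (-(u (k₀.succAbove l) - m) - ε * |u (k₀.succAbove l) - m|) ≤
      ∑ l : Fin n, (-u (k₀.succAbove l) - ε * |u (k₀.succAbove l)| + ε * D) := by
    refine Finset.sum_le_sum fun l _ => ?_
    have h3 : |u (k₀.succAbove l)| ≤ |u (k₀.succAbove l) - m| + D := by
      have := abs_add_le (u (k₀.succAbove l) - m) m
      rw [sub_add_cancel] at this
      have h4 : |m| ≤ D := abs_le.2 ⟨by linarith, by linarith⟩
      linarith
    have := mul_le_mul_of_nonneg_left h3 hε
    linarith
  rw [Finset.sum_sub_distrib, Finset.sum_neg_distrib, ← Finset.mul_sum, Finset.sum_add_distrib,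
    Finset.sum_const, Finset.card_univ, Fintype.card_fin, nsmul_eq_mul] at h2
  linarith

theorem AdmissibleExponents.comp_perm {n : ℕ} {S : Fin (n + 2) → Fin (n + 2) → ℝ} {ε : ℝ}
    {a b : Fin (n + 2)} (hS : AdmissibleExponents ε a b S) (σ : Equiv.Perm (Fin (n + 2))) :
    AdmissibleExponents ε (σ.symm a) (σ.symm b) fun i j => S (σ i) (σ j) := by
  have hsum : ∀ B : Finset (Fin (n + 2)), ∑ i ∈ B, ∑ j ∈ B, S (σ i) (σ j) =
      ∑ i ∈ B.map σ.toEmbedding, ∑ j ∈ B.map σ.toEmbedding, S i j := by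
    intro B; simp [Finset.sum_map]
  refine ⟨fun i => hS.diag _, fun B hB hab => ?_, fun B ha hb => ?_⟩
  · rw [hsum]
    simpa using hS.collide (B.map σ.toEmbedding) (by simpa using hB) (by
      simpa [Finset.mem_map_equiv] using hab)
  · rw [hsum, hsum]
    simpa using hS.escape (B.map σ.toEmbedding) (by simpa [Finset.mem_map_equiv] using ha)
      (by simpa [Finset.mem_map_equiv] using hb)

theorem exists_sum_log_dist_le {n : ℕ} {S : Fin (n + 2) → Fin (n + 2) → ℝ} {ε A : ℝ}
    (hε : 0 ≤ ε) {a b : Fin (n + 2)} (hS : AdmissibleExponents ε a b S)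
    (hA : ∀ i j, |S i j| ≤ A) {p : Fin (n + 2) → ℝ} (hp : Function.Injective p)
    (hab : |p a - p b| = 1) :
    ∃ (σ : Equiv.Perm (Fin (n + 2))) (k₀ : Fin (n + 1)), GapBetween (σ.symm a) (σ.symm b) k₀ ∧
      ∑ i, ∑ j, S i j * Real.log |p i - p j| ≤
      (2 * (A * Real.log (n + 2) * (n + 2) ^ 2) + ε * Real.log (n + 2) * n) +
      ∑ l : Fin n,
        (-Real.log (p (σ (k₀.succAbove l).succ) - p (σ (k₀.succAbove l).castSucc)) -
          ε * |Real.log (p (σ (k₀.succAbove l).succ) - p (σ (k₀.succAbove l).castSucc))|) := by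
  have hq : StrictMono (p ∘ Tuple.sort p) :=
    (Tuple.monotone_sort p).strictMono_of_injective (hp.comp (Tuple.sort p).injective)
  obtain ⟨k₀, hk₀, h⟩ := sum_log_dist_le_of_strictMono hε (hS.comp_perm (Tuple.sort p))
    (fun i j => hA _ _) hq (by simpa using hab)
  refine ⟨Tuple.sort p, k₀, hk₀, le_of_eq_of_le ?_ h⟩
  rw [← Equiv.sum_comp (Tuple.sort p)]
  refine sum_congr rfl fun i _ => ?_
  rw [← Equiv.sum_comp (Tuple.sort p)]
  rfl

theorem integrable_exp_neg_log_sub_abs_log {ε : ℝ} (hε : 0 < ε) :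
    Integrable fun t : ℝ => Real.exp (-Real.log t - ε * |Real.log t|) := by
  set g : ℝ → ℝ := fun t => Real.exp (-Real.log t - ε * |Real.log t|) with hg
  have h1 : IntegrableOn g (Set.Ioo 0 1) := by
    refine ((intervalIntegral.integrableOn_Ioo_rpow_iff (s := ε - 1) zero_lt_one).2
      (by linarith)).congr_fun (fun t ht => ?_) measurableSet_Ioo
    simp only [hg]
    rw [Real.rpow_def_of_pos ht.1, abs_of_nonpos (Real.log_nonpos ht.1.le ht.2.le)]
    ring_nf
  have h2 : IntegrableOn g (Set.Ici 1) := by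
    rw [integrableOn_Ici_iff_integrableOn_Ioi]
    refine (integrableOn_Ioi_rpow_of_lt (a := -ε - 1) (by linarith) zero_lt_one).congr_fun
      (fun t ht => ?_) measurableSet_Ioi
    simp only [hg]
    rw [Real.rpow_def_of_pos (zero_lt_one.trans ht), abs_of_nonneg (Real.log_nonneg (le_of_lt ht))]
    ring_nf
  have h3 : IntegrableOn g (Set.Ioi 0) := by
    rw [← Set.Ioo_union_Ici_eq_Ioi (zero_lt_one (α := ℝ))]
    exact h1.union h2
  have h4 : IntegrableOn g (Set.Iic 0) := by
    have : g = fun t => g (-t) := by ext t; simp [hg]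
    rw [this]
    refine IntegrableOn.comp_neg_Iic ?_
    rw [neg_zero]
    rwa [integrableOn_Ici_iff_integrableOn_Ioi]
  rw [← integrableOn_univ, ← Set.Iic_union_Ioi (a := (0 : ℝ))]
  exact h4.union h3

/-- The points `0, 1, x 0, …, x (n - 1)` on the real line. -/
def knPoints {n : ℕ} (x : Fin n → ℝ) : Fin (n + 2) → ℝ := Fin.cons 0 (Fin.cons 1 x)

/-- The linear part of `knPoints`. -/
def knPointsLinear (n : ℕ) : (Fin n → ℝ) →ₗ[ℝ] (Fin (n + 2) → ℝ) where
  toFun x := Fin.cons 0 (Fin.cons 0 x)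
  map_add' x y := by
    ext i; refine Fin.cases ?_ (fun i => Fin.cases ?_ (fun i => ?_) i) i <;> simp
  map_smul' c x := by
    ext i; refine Fin.cases ?_ (fun i => Fin.cases ?_ (fun i => ?_) i) i <;> simp

theorem knPoints_eq_linear_add {n : ℕ} (x : Fin n → ℝ) (i : Fin (n + 2)) :
    knPoints x i = knPointsLinear n x i + knPoints 0 i := by
  refine Fin.cases ?_ (fun i => Fin.cases ?_ (fun i => ?_) i) i <;>
    simp [knPoints, knPointsLinear]

theorem ae_injective_knPoints (n : ℕ) :
    ∀ᵐ x : Fin n → ℝ, Function.Injective (knPoints x) := by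
  have h0 : ∀ᵐ x : Fin n → ℝ, ∀ j, x j ≠ 0 :=
    Filter.eventually_all.2 fun j => Measure.ae_eval_ne (fun _ => volume) j 0
  have h1 : ∀ᵐ x : Fin n → ℝ, ∀ j, x j ≠ 1 :=
    Filter.eventually_all.2 fun j => Measure.ae_eval_ne (fun _ => volume) j 1
  have h2 : ∀ᵐ x : Fin n → ℝ, ∀ i j, i ≠ j → x i ≠ x j := by
    refine Filter.eventually_all.2 fun i => Filter.eventually_all.2 fun j => ?_
    by_cases hij : i = j
    · simp [hij]
    · have := Measure.addHaar_submodule (volume : Measure (Fin n → ℝ))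
        (LinearMap.ker (LinearMap.proj (R := ℝ) (φ := fun _ : Fin n => ℝ) i - LinearMap.proj j))
        (fun h => by
          have h' : (Pi.single i 1 : Fin n → ℝ) ∈ LinearMap.ker
              (LinearMap.proj (R := ℝ) (φ := fun _ : Fin n => ℝ) i - LinearMap.proj j) := by
            rw [h]; trivial
          simp [Ne.symm hij] at h')
      filter_upwards [measure_eq_zero_iff_ae_notMem.1 this] with x hx _ h
      exact hx (by simp [h])
  filter_upwards [h0, h1, h2] with x h0 h1 h2
  rw [knPoints, Fin.cons_injective_iff, Fin.cons_injective_iff]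
  refine ⟨?_, ?_, fun i j h => by_contra fun hij => h2 i j hij h⟩
  · rintro ⟨i, hi⟩
    revert hi
    refine Fin.cases ?_ (fun i => ?_) i
    · simp
    · simpa using h0 i
  · rintro ⟨i, hi⟩
    exact h1 i hi

/-- The linear part of the gaps between consecutive points, in the order given by `σ`, with the
gap `k₀` left out. -/
def knGapsLinear {n : ℕ} (σ : Equiv.Perm (Fin (n + 2))) (k₀ : Fin (n + 1)) :
    (Fin n → ℝ) →ₗ[ℝ] (Fin n → ℝ) :=
  LinearMap.pi fun l =>
    (LinearMap.proj (R := ℝ) (φ := fun _ => ℝ) (σ (k₀.succAbove l).succ) -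
      LinearMap.proj (σ (k₀.succAbove l).castSucc)) ∘ₗ knPointsLinear n

theorem det_knGapsLinear_ne_zero {n : ℕ} {σ : Equiv.Perm (Fin (n + 2))} {k₀ : Fin (n + 1)}
    (h : GapBetween (σ.symm 0) (σ.symm 1) k₀) : LinearMap.det (knGapsLinear σ k₀) ≠ 0 := by
  intro hdet
  obtain ⟨x, hx, hx0⟩ := Submodule.exists_mem_ne_zero_of_ne_bot
    (LinearMap.bot_lt_ker_of_det_eq_zero hdet).ne'
  refine hx0 ?_
  set q : Fin (n + 2) → ℝ := fun i => knPointsLinear n x (σ i) with hq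
  have hgap : ∀ k, k ≠ k₀ → q k.succ = q k.castSucc := by
    intro k hk
    obtain ⟨l, rfl⟩ := Fin.exists_succAbove_eq hk
    have := congrFun (LinearMap.mem_ker.1 hx) l
    simpa [knGapsLinear, sub_eq_zero] using this
  have hlow : ∀ i, i ≤ k₀.castSucc → q i = q 0 := by
    intro i
    induction i using Fin.induction with
    | zero => intro _; rfl
    | succ k ih =>
      intro hk
      have hlt : k.castSucc < k₀.castSucc := Fin.castSucc_lt_succ.trans_le hk
      rw [hgap k (by rintro rfl; exact lt_irrefl _ hlt), ih hlt.le]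
  have hhigh : ∀ i, k₀.succ ≤ i → q i = q (Fin.last _) := by
    intro i
    induction i using Fin.reverseInduction with
    | last => intro _; rfl
    | cast k ih =>
      intro hk
      have hlt : k₀.succ < k.succ := hk.trans_lt Fin.castSucc_lt_succ
      rw [← hgap k (by rintro rfl; exact lt_irrefl _ hlt), ih hlt.le]
  have q0 : q (σ.symm 0) = 0 := by simp [hq, knPointsLinear]
  have q1 : q (σ.symm 1) = 0 := by
    simp only [hq, Equiv.apply_symm_apply]
    rfl
  have hq0 : ∀ i, q i = 0 := by
    intro i
    rcases le_or_gt i k₀.castSucc with hi | hi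
    · rw [hlow i hi]
      rcases h with h | h
      · rw [← hlow _ h.1, q0]
      · rw [← hlow _ h.1, q1]
    · have hi' : k₀.succ ≤ i := Fin.castSucc_lt_iff_succ_le.1 hi
      rw [hhigh i hi']
      rcases h with h | h
      · rw [← hhigh _ h.2, q1]
      · rw [← hhigh _ h.2, q0]
  ext j
  have := hq0 (σ.symm j.succ.succ)
  simpa [hq, knPointsLinear] using this

theorem integrable_prod_gaps {n : ℕ} {ε : ℝ} (hε : 0 < ε) {σ : Equiv.Perm (Fin (n + 2))}
    {k₀ : Fin (n + 1)} (h : GapBetween (σ.symm 0) (σ.symm 1) k₀) :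
    Integrable fun x : Fin n → ℝ => Real.exp (∑ l : Fin n,
      (-Real.log (knPoints x (σ (k₀.succAbove l).succ) -
          knPoints x (σ (k₀.succAbove l).castSucc)) -
        ε * |Real.log (knPoints x (σ (k₀.succAbove l).succ) -
          knPoints x (σ (k₀.succAbove l).castSucc))|)) := by
  have hdet := det_knGapsLinear_ne_zero h
  have h1 : Integrable fun y : Fin n → ℝ =>
      ∏ l, Real.exp (-Real.log (y l) - ε * |Real.log (y l)|) :=
    Integrable.fintype_prod (fun _ => integrable_exp_neg_log_sub_abs_log hε)
  have h2 := h1.comp_add_right fun l : Fin n =>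
    knPoints 0 (σ (k₀.succAbove l).succ) - knPoints 0 (σ (k₀.succAbove l).castSucc)
  have h3 := h2.smul_measure (c := ENNReal.ofReal |(LinearMap.det (knGapsLinear σ k₀))⁻¹|)
    ENNReal.ofReal_ne_top
  rw [← Measure.map_linearMap_addHaar_eq_smul_addHaar _ hdet] at h3
  have h4 := h3.comp_measurable
    (LinearMap.continuous_of_finiteDimensional (knGapsLinear σ k₀)).measurable
  refine h4.congr (Filter.Eventually.of_forall fun x => ?_)
  simp only [Function.comp_def, Real.exp_sum]
  refine prod_congr rfl fun l _ => ?_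
  have : (knGapsLinear σ k₀ x + fun l : Fin n => knPoints 0 (σ (k₀.succAbove l).succ) -
      knPoints 0 (σ (k₀.succAbove l).castSucc)) l = knPoints x (σ (k₀.succAbove l).succ) -
          knPoints x (σ (k₀.succAbove l).castSucc) := by
    rw [knPoints_eq_linear_add x (σ (k₀.succAbove l).succ),
      knPoints_eq_linear_add x (σ (k₀.succAbove l).castSucc)]
    simp [knGapsLinear]
    ring
  rw [this]

/-- A single integrable function dominates all products of powers of distances whose exponents are
admissible with margin `ε` and bounded by `A`. -/
theorem exists_integrable_bound (n : ℕ) {ε : ℝ} (hε : 0 < ε) (A : ℝ) :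
    ∃ bound : (Fin n → ℝ) → ℝ, Integrable bound ∧ ∀ᵐ x,
      ∀ S : Fin (n + 2) → Fin (n + 2) → ℝ, AdmissibleExponents ε 0 1 S → (∀ i j, |S i j| ≤ A) →
        Real.exp (∑ i, ∑ j, S i j * Real.log |knPoints x i - knPoints x j|) ≤ bound x := by
  classical
  set C := 2 * (A * Real.log (n + 2) * (n + 2) ^ 2) + ε * Real.log (n + 2) * n
  refine ⟨fun x => ∑ q : Equiv.Perm (Fin (n + 2)) × Fin (n + 1) with
      GapBetween (q.1.symm 0) (q.1.symm 1) q.2,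
    Real.exp C * Real.exp (∑ l : Fin n,
      (-Real.log (knPoints x (q.1 (q.2.succAbove l).succ) -
          knPoints x (q.1 (q.2.succAbove l).castSucc)) -
        ε * |Real.log (knPoints x (q.1 (q.2.succAbove l).succ) -
          knPoints x (q.1 (q.2.succAbove l).castSucc))|)), ?_, ?_⟩
  · refine integrable_finsetSum _ fun q hq => ?_
    exact (integrable_prod_gaps hε (Finset.mem_filter.1 hq).2).const_mul _
  · filter_upwards [ae_injective_knPoints n] with x hx S hS hA
    obtain ⟨σ, k₀, hk₀, h⟩ := exists_sum_log_dist_le hε.le hS hA hx (by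
      simp [knPoints])
    refine le_trans ?_ (Finset.single_le_sum (f := fun q : Equiv.Perm (Fin (n + 2)) × Fin (n + 1) =>
      Real.exp C * Real.exp (∑ l : Fin n,
      (-Real.log (knPoints x (q.1 (q.2.succAbove l).succ) -
          knPoints x (q.1 (q.2.succAbove l).castSucc)) -
        ε * |Real.log (knPoints x (q.1 (q.2.succAbove l).succ) -
          knPoints x (q.1 (q.2.succAbove l).castSucc))|))) (fun q _ => by positivity)
      (Finset.mem_filter.2 ⟨Finset.mem_univ (σ, k₀), hk₀⟩))
    rw [← Real.exp_add]
    exact Real.exp_le_exp.2 h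

theorem norm_exp_smul_le {E : Type*} [NormedAddCommGroup E] [NormedSpace ℂ E] (ℓ : E →L[ℂ] ℂ)
    {s : E} {r B : ℝ} (hr : 0 < r)
    (h : ∀ s', ‖s' - s‖ ≤ r → Real.exp (ℓ s').re ≤ B) :
    ‖Complex.exp (ℓ s) • ℓ‖ ≤ B / r := by
  have hB : 0 ≤ B := (Real.exp_pos _).le.trans (h s (by simpa using hr.le))
  refine ContinuousLinearMap.opNorm_le_bound _ (by positivity) fun v => ?_
  rcases eq_or_ne v 0 with rfl | hv
  · simp
  have hv' : 0 < ‖v‖ := norm_pos_iff.2 hv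
  obtain ⟨c, hc, hcv⟩ := RCLike.exists_norm_eq_mul_self (ℓ v)
  have h1 := h (s + ((r / ‖v‖ : ℝ) * c : ℂ) • v) (by
    rw [add_sub_cancel_left, norm_smul, norm_mul, hc, Complex.norm_real, Real.norm_eq_abs,
      abs_of_pos (by positivity), mul_one, div_mul_cancel₀ _ hv'.ne'])
  have h2 : (ℓ (s + ((r / ‖v‖ : ℝ) * c : ℂ) • v)).re = (ℓ s).re + r / ‖v‖ * ‖ℓ v‖ := by
    rw [map_add, map_smul, smul_eq_mul, mul_assoc, ← hcv, Complex.add_re]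
    congr 1
    exact Complex.re_ofReal_mul _ _
  rw [h2, Real.exp_add] at h1
  have h3 : r / ‖v‖ * ‖ℓ v‖ ≤ Real.exp (r / ‖v‖ * ‖ℓ v‖) := by
    linarith [Real.add_one_le_exp (r / ‖v‖ * ‖ℓ v‖)]
  have h4 := (mul_le_mul_of_nonneg_left h3 (Real.exp_pos (ℓ s).re).le).trans h1
  rw [smul_apply, norm_smul, Complex.norm_exp]
  calc Real.exp (ℓ s).re * ‖ℓ v‖ =
      (Real.exp (ℓ s).re * (r / ‖v‖ * ‖ℓ v‖)) / r * ‖v‖ := by field_simp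
    _ ≤ B / r * ‖v‖ := by gcongr

theorem differentiableOn_integral_exp {E α : Type*} [NormedAddCommGroup E] [NormedSpace ℂ E]
    [MeasurableSpace α] {μ : Measure α} {ℓ : α → E →L[ℂ] ℂ} (hℓ : AEStronglyMeasurable ℓ μ)
    {U : Set E}
    (hdom : ∀ s₀ ∈ U, ∃ r > 0, ∃ bound : α → ℝ, Integrable bound μ ∧
      ∀ᵐ x ∂μ, ∀ s ∈ Metric.ball s₀ r, Real.exp (ℓ x s).re ≤ bound x) :
    (∀ s ∈ U, Integrable (fun x => Complex.exp (ℓ x s)) μ) ∧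
      DifferentiableOn ℂ (fun s => ∫ x, Complex.exp (ℓ x s) ∂μ) U := by
  have hmeas : ∀ s, AEStronglyMeasurable (fun x => Complex.exp (ℓ x s)) μ := fun s =>
    Complex.continuous_exp.comp_aestronglyMeasurable (hℓ.apply_continuousLinearMap s)
  have hint : ∀ s ∈ U, Integrable (fun x => Complex.exp (ℓ x s)) μ := by
    intro s hs
    obtain ⟨r, hr, bound, hb, h⟩ := hdom s hs
    refine hb.mono' (hmeas s) ?_
    filter_upwards [h] with x hx
    rw [Complex.norm_exp]
    exact hx s (Metric.mem_ball_self hr)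
  refine ⟨hint, fun s hs => ?_⟩
  obtain ⟨r, hr, bound, hb, h⟩ := hdom s hs
  refine DifferentiableAt.differentiableWithinAt (HasFDerivAt.differentiableAt
    (hasFDerivAt_integral_of_dominated_of_fderiv_le
    (F' := fun s x => Complex.exp (ℓ x s) • ℓ x)
    (bound := fun x => bound x / (r / 3)) (Metric.ball_mem_nhds s (half_pos hr))
    (Filter.Eventually.of_forall hmeas) (hint s hs) ((hmeas s).smul hℓ) ?_ (hb.div_const _) ?_))
  · filter_upwards [h] with x hx s' hs'
    refine norm_exp_smul_le _ (by positivity) fun s'' hs'' => hx s'' ?_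
    rw [Metric.mem_ball] at hs' ⊢
    rw [← dist_eq_norm] at hs''
    linarith [dist_triangle s'' s' s]
  · exact Filter.Eventually.of_forall fun x s' _ => (ℓ x).hasFDerivAt.cexp

/-- The exponents of the pairwise distances between the points `knPoints x`, each split evenly
between the two orderings of the pair. -/
noncomputable def knExponents {n : ℕ} (a b : Fin n → ℝ) (c : Fin n → Fin n → ℝ) :
    Fin (n + 2) → Fin (n + 2) → ℝ :=
  Fin.cons (Fin.cons 0 (Fin.cons 0 fun j => a j / 2))
    (Fin.cons (Fin.cons 0 (Fin.cons 0 fun j => b j / 2)) fun i =>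
      Fin.cons (a i / 2) (Fin.cons (b i / 2) fun j =>
        (if i < j then c i j / 2 else 0) + (if j < i then c j i / 2 else 0)))

theorem knExponents_diag {n : ℕ} (a b : Fin n → ℝ) (c : Fin n → Fin n → ℝ) (i : Fin (n + 2)) :
    knExponents a b c i i = 0 := by
  refine Fin.cases ?_ (fun i => Fin.cases ?_ (fun i => ?_) i) i <;> simp [knExponents]

theorem continuous_knExponents {n : ℕ} {E : Type*} [TopologicalSpace E] {a b : E → Fin n → ℝ}
    {c : E → Fin n → Fin n → ℝ} (ha : Continuous a) (hb : Continuous b) (hc : Continuous c)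
    (i j : Fin (n + 2)) : Continuous fun s => knExponents (a s) (b s) (c s) i j := by
  have ha' : ∀ j, Continuous fun s => a s j := fun j => (continuous_apply j).comp ha
  have hb' : ∀ j, Continuous fun s => b s j := fun j => (continuous_apply j).comp hb
  have hc' : ∀ i j, Continuous fun s => c s i j := fun i j =>
    (continuous_apply j).comp ((continuous_apply i).comp hc)
  refine Fin.cases ?_ (fun i => Fin.cases ?_ (fun i => ?_) i) i <;>
  refine Fin.cases ?_ (fun j => Fin.cases ?_ (fun j => ?_) j) j <;>
  simp only [knExponents, Fin.cons_zero, Fin.cons_succ]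
  case _ => exact continuous_const
  case _ => exact continuous_const
  case _ => exact (ha' j).div_const 2
  case _ => exact continuous_const
  case _ => exact continuous_const
  case _ => exact (hb' j).div_const 2
  case _ => exact (ha' i).div_const 2
  case _ => exact (hb' i).div_const 2
  case _ =>
    refine Continuous.add ?_ ?_
    · split_ifs
      · exact (hc' i j).div_const 2
      · exact continuous_const
    · split_ifs
      · exact (hc' j i).div_const 2
      · exact continuous_const

theorem sum_knExponents_mul {n : ℕ} (a b : Fin n → ℝ) (c : Fin n → Fin n → ℝ)
    (w : Fin (n + 2) → Fin (n + 2) → ℝ) (hw : ∀ i j, w i j = w j i) :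
    ∑ i, ∑ j, knExponents a b c i j * w i j =
      (∑ j, a j * w 0 j.succ.succ) + (∑ j, b j * w 1 j.succ.succ) +
        ∑ p ∈ univ.filter (fun p : Fin n × Fin n => p.1 < p.2),
          c p.1 p.2 * w p.1.succ.succ p.2.succ.succ := by
  have h1 : ∑ i : Fin n, ∑ j : Fin n, (if j < i then c j i / 2 else 0) *
      w i.succ.succ j.succ.succ = ∑ i : Fin n, ∑ j : Fin n, (if i < j then c i j / 2 else 0) *
      w i.succ.succ j.succ.succ := by
    rw [Finset.sum_comm]
    refine sum_congr rfl fun i _ => sum_congr rfl fun j _ => ?_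
    rw [hw]
  have h2 : ∑ p ∈ univ.filter (fun p : Fin n × Fin n => p.1 < p.2),
      c p.1 p.2 * w p.1.succ.succ p.2.succ.succ =
      2 * ∑ i : Fin n, ∑ j : Fin n, (if i < j then c i j / 2 else 0) *
      w i.succ.succ j.succ.succ := by
    rw [Finset.sum_filter, Fintype.sum_prod_type, Finset.mul_sum]
    refine sum_congr rfl fun i _ => ?_
    rw [Finset.mul_sum]
    refine sum_congr rfl fun j _ => ?_
    split_ifs <;> ring
  have hw0 : ∀ j : Fin n, w j.succ.succ 0 = w 0 j.succ.succ := fun j => hw _ _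
  have hw1 : ∀ j : Fin n, w j.succ.succ (Fin.succ 0) = w (Fin.succ 0) j.succ.succ :=
    fun j => hw _ _
  rw [h2]
  simp only [Fin.sum_univ_succ, knExponents, Fin.cons_zero, Fin.cons_succ, add_mul,
    Finset.sum_add_distrib, h1, hw0, hw1, ← Fin.succ_zero_eq_one]
  have h3 : ∀ f g : Fin n → ℝ, ∑ x, f x * g x = 2 * ∑ x, f x / 2 * g x := by
    intro f g; rw [Finset.mul_sum]; exact sum_congr rfl fun x _ => by ring
  rw [h3 a, h3 b]
  ring

theorem sum_knExponents_subset {n : ℕ} (a b : Fin n → ℝ) (c : Fin n → Fin n → ℝ)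
    (B : Finset (Fin (n + 2))) (J : Finset (Fin n)) (hJ : ∀ j, j ∈ J ↔ j.succ.succ ∈ B) :
    ∑ i ∈ B, ∑ j ∈ B, knExponents a b c i j =
      (if 0 ∈ B then ∑ j ∈ J, a j else 0) + (if 1 ∈ B then ∑ j ∈ J, b j else 0) +
        ∑ p ∈ (J ×ˢ J).filter (fun p => p.1 < p.2), c p.1 p.2 := by
  have h := sum_knExponents_mul a b c (fun i j => if i ∈ B ∧ j ∈ B then 1 else 0)
    (fun i j => by simp only [and_comm])
  have h1 : ∑ i ∈ B, ∑ j ∈ B, knExponents a b c i j =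
      ∑ i, ∑ j, knExponents a b c i j * (if i ∈ B ∧ j ∈ B then 1 else 0) := by
    rw [← Finset.sum_subset (Finset.subset_univ B) fun i _ hi => by simp [hi]]
    refine sum_congr rfl fun i hi => ?_
    rw [← Finset.sum_subset (Finset.subset_univ B) fun j _ hj => by simp [hj]]
    exact sum_congr rfl fun j hj => by simp [hi, hj]
  have h2 : ∀ (P : Prop) [Decidable P] (f : Fin n → ℝ),
      ∑ j, f j * (if P ∧ j.succ.succ ∈ B then 1 else 0) = if P then ∑ j ∈ J, f j else 0 := by
    intro P _ f
    by_cases hP : P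
    · rw [if_pos hP, ← Finset.sum_subset (Finset.subset_univ J) fun j _ hj => by
        simp [mt (hJ j).2 hj]]
      exact sum_congr rfl fun j hj => by simp [hP, (hJ j).1 hj]
    · simp [hP]
  rw [h1, h, h2, h2]
  congr 1
  rw [← Finset.sum_subset (Finset.filter_subset_filter _ (Finset.subset_univ (J ×ˢ J)))]
  · refine sum_congr rfl fun p hp => ?_
    simp only [Finset.mem_filter, Finset.mem_product] at hp
    simp [(hJ _).1 hp.1.1, (hJ _).1 hp.1.2]
  · intro p hp hp'
    have hlt : p.1 < p.2 := by simpa using hp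
    rw [if_neg, mul_zero]
    rintro ⟨h3, h4⟩
    exact hp' (by simp [hlt, (hJ _).2 h3, (hJ _).2 h4])

theorem card_eq_of_mem_iff {n : ℕ} (B : Finset (Fin (n + 2))) (J : Finset (Fin n))
    (hJ : ∀ j, j ∈ J ↔ j.succ.succ ∈ B) :
    B.card = (if 0 ∈ B then 1 else 0) + (if 1 ∈ B then 1 else 0) + J.card := by
  have h1 : B.card = ∑ i, if i ∈ B then 1 else 0 := by simp
  have h2 : J = univ.filter fun j => j.succ.succ ∈ B := by ext; simp [hJ]
  rw [h1, h2, Finset.card_filter, Fin.sum_univ_succ, Fin.sum_univ_succ, ← add_assoc]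
  rfl

theorem sum_filter_lt_eq_add_compl {n : ℕ} (c : Fin n → Fin n → ℝ) (K : Finset (Fin n)) :
    ∑ p ∈ univ.filter (fun p : Fin n × Fin n => p.1 < p.2), c p.1 p.2 =
      (∑ p ∈ (K ×ˢ K).filter (fun p => p.1 < p.2), c p.1 p.2) +
      (∑ i ∈ K, ∑ j ∈ Kᶜ, if i < j then c i j else c j i) +
      ∑ p ∈ (Kᶜ ×ˢ Kᶜ).filter (fun p => p.1 < p.2), c p.1 p.2 := by
  have h1 : ∑ i ∈ K, ∑ j ∈ Kᶜ, (if i < j then c i j else c j i) =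
      (∑ i ∈ K, ∑ j ∈ Kᶜ, if i < j then c i j else 0) +
      ∑ i ∈ Kᶜ, ∑ j ∈ K, if i < j then c i j else 0 := by
    rw [Finset.sum_comm (s := Kᶜ), ← Finset.sum_add_distrib]
    refine sum_congr rfl fun i hi => ?_
    rw [← Finset.sum_add_distrib]
    refine sum_congr rfl fun j hj => ?_
    have hij : i ≠ j := by
      rintro rfl; exact Finset.mem_compl.1 hj hi
    rcases lt_or_gt_of_ne hij with h | h
    · simp [h, h.not_gt]
    · simp [h, h.not_gt]
  simp only [h1, Finset.sum_filter, Finset.sum_product, Fintype.sum_prod_type]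
  have h2 : ∀ f : Fin n → Fin n → ℝ, ∑ i, ∑ j, f i j = (∑ i ∈ K, ∑ j ∈ K, f i j) +
      (∑ i ∈ K, ∑ j ∈ Kᶜ, f i j) + ((∑ i ∈ Kᶜ, ∑ j ∈ K, f i j) + ∑ i ∈ Kᶜ, ∑ j ∈ Kᶜ, f i j) := by
    intro f
    rw [← Finset.sum_add_sum_compl K, ← Finset.sum_add_distrib, ← Finset.sum_add_distrib]
    simp only [Finset.sum_add_sum_compl]
  rw [h2]
  ring

/-- A family of exponents satisfying strict convergence conditions at `s₀` satisfies them with a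
uniform margin near `s₀`. -/
theorem exists_uniform_margin {n : ℕ} {E : Type*} [PseudoMetricSpace E]
    {S : E → Fin (n + 2) → Fin (n + 2) → ℝ} (hS : ∀ i j, Continuous fun s => S s i j)
    (hdiag : ∀ s i, S s i i = 0) {a b : Fin (n + 2)} {s₀ : E}
    (hcollide : ∀ B : Finset (Fin (n + 2)), 2 ≤ B.card → ¬(a ∈ B ∧ b ∈ B) →
      0 < (∑ i ∈ B, ∑ j ∈ B, S s₀ i j) + (B.card - 1))
    (hescape : ∀ B : Finset (Fin (n + 2)), a ∈ B → b ∈ B → B ≠ univ →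
      (∑ i, ∑ j, S s₀ i j) - (∑ i ∈ B, ∑ j ∈ B, S s₀ i j) + ((n : ℝ) + 2 - B.card) < 0) :
    ∃ ε > 0, ∃ A : ℝ, ∃ r > 0, ∀ s ∈ Metric.ball s₀ r,
      AdmissibleExponents ε a b (S s) ∧ ∀ i j, |S s i j| ≤ A := by
  have hQ : ∀ B : Finset (Fin (n + 2)), Continuous fun q : ℝ × E => ∑ i ∈ B, ∑ j ∈ B, S q.2 i j :=
    fun B => continuous_finsetSum _ fun i _ => continuous_finsetSum _ fun j _ =>
      (hS i j).comp continuous_snd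
  have h1 : ∀ᶠ q : ℝ × E in nhds (0, s₀), ∀ B : Finset (Fin (n + 2)), 2 ≤ B.card →
      ¬(a ∈ B ∧ b ∈ B) →
      q.1 * ((B.card : ℝ) - 1) < (∑ i ∈ B, ∑ j ∈ B, S q.2 i j) + (B.card - 1) := by
    refine Filter.eventually_all.2 fun B => ?_
    by_cases h : 2 ≤ B.card ∧ ¬(a ∈ B ∧ b ∈ B)
    · have := ContinuousAt.eventually_lt (x₀ := ((0 : ℝ), s₀))
        (f := fun q : ℝ × E => q.1 * ((B.card : ℝ) - 1))
        (g := fun q : ℝ × E => (∑ i ∈ B, ∑ j ∈ B, S q.2 i j) + (B.card - 1))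
        (continuous_fst.mul continuous_const).continuousAt
        ((hQ B).add continuous_const).continuousAt (by simpa using hcollide B h.1 h.2)
      filter_upwards [this] with q hq _ _ using hq
    · exact Filter.Eventually.of_forall fun q h1 h2 => absurd ⟨h1, h2⟩ h
  have h2 : ∀ᶠ q : ℝ × E in nhds (0, s₀), ∀ B : Finset (Fin (n + 2)), a ∈ B → b ∈ B →
      B ≠ univ → (∑ i, ∑ j, S q.2 i j) - (∑ i ∈ B, ∑ j ∈ B, S q.2 i j) +
        (1 + q.1) * ((n : ℝ) + 2 - B.card) < 0 := by
    refine Filter.eventually_all.2 fun B => ?_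
    by_cases h : a ∈ B ∧ b ∈ B ∧ B ≠ univ
    · have := ContinuousAt.eventually_lt (x₀ := ((0 : ℝ), s₀))
        (f := fun q : ℝ × E => (∑ i, ∑ j, S q.2 i j) - (∑ i ∈ B, ∑ j ∈ B, S q.2 i j) +
        (1 + q.1) * ((n : ℝ) + 2 - B.card))
        (g := fun _ => 0)
        (((hQ univ).sub (hQ B)).add
          ((continuous_const.add continuous_fst).mul continuous_const)).continuousAt
        continuousAt_const (by simpa using hescape B h.1 h.2.1 h.2.2)
      filter_upwards [this] with q hq _ _ _ using hq
    · exact Filter.Eventually.of_forall fun q h1 h2 h3 => absurd ⟨h1, h2, h3⟩ h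
  have h3 : ∀ᶠ q : ℝ × E in nhds (0, s₀), ∑ i, ∑ j, |S q.2 i j| < (∑ i, ∑ j, |S s₀ i j|) + 1 :=
    ContinuousAt.eventually_lt
      (continuous_finsetSum _ fun i _ => continuous_finsetSum _ fun j _ =>
        ((hS i j).comp continuous_snd).abs).continuousAt continuousAt_const (by simp)
  obtain ⟨r, hr, h⟩ := Metric.eventually_nhds_iff_ball.1 (h1.and (h2.and h3))
  refine ⟨r / 2, half_pos hr, (∑ i, ∑ j, |S s₀ i j|) + 1, r, hr, fun s hs => ?_⟩
  obtain ⟨H1, H2, H3⟩ := h (r / 2, s) (by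
    rw [← ball_prod_same]
    exact ⟨by simpa [abs_of_pos hr] using half_lt_self hr, hs⟩)
  refine ⟨⟨hdiag s, fun B hB hab => ?_, fun B ha hb => ?_⟩, fun i j => ?_⟩
  · rcases Nat.lt_or_ge B.card 2 with hc | hc
    · have : B.card = 1 := le_antisymm (by omega) (Finset.card_pos.2 hB)
      obtain ⟨i, rfl⟩ := Finset.card_eq_one.1 this
      simp [hdiag]
    · exact (H1 B hc hab).le
  · by_cases hu : B = univ
    · subst hu; simp
    · exact (H2 B ha hb hu).le
  · refine le_trans ?_ H3.le
    exact (Finset.single_le_sum (f := fun j => |S s i j|) (fun _ _ => abs_nonneg _)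
      (Finset.mem_univ j)).trans (Finset.single_le_sum (f := fun i => ∑ j, |S s i j|)
        (fun _ _ => Finset.sum_nonneg fun _ _ => abs_nonneg _) (Finset.mem_univ i))

theorem collide_of_region {n : ℕ} {a b : Fin n → ℝ} {c : Fin n → Fin n → ℝ}
    (hAa : ∀ j, -1 < a j) (hAb : ∀ j, -1 < b j) (hAc : ∀ i j, i < j → -1 < c i j)
    (hB : ∀ J : Finset (Fin n), 2 ≤ J.card → -(J.card : ℝ) <
      (∑ j ∈ J, a j) + ∑ p ∈ (J ×ˢ J).filter (fun p => p.1 < p.2), c p.1 p.2)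
    (hC : ∀ J : Finset (Fin n), 2 ≤ J.card → -(J.card : ℝ) <
      (∑ j ∈ J, b j) + ∑ p ∈ (J ×ˢ J).filter (fun p => p.1 < p.2), c p.1 p.2)
    (hD : ∀ J : Finset (Fin n), 3 ≤ J.card → -(J.card : ℝ) + 1 <
      ∑ p ∈ (J ×ˢ J).filter (fun p => p.1 < p.2), c p.1 p.2)
    (B : Finset (Fin (n + 2))) (hcard : 2 ≤ B.card) (h01 : ¬(0 ∈ B ∧ 1 ∈ B)) :
    0 < (∑ i ∈ B, ∑ j ∈ B, knExponents a b c i j) + (B.card - 1) := by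
  set J : Finset (Fin n) := univ.filter fun j => j.succ.succ ∈ B with hJ
  have hJB : ∀ j, j ∈ J ↔ j.succ.succ ∈ B := by simp [hJ]
  have hone : ∀ j : Fin n, (({j} ×ˢ {j} : Finset (Fin n × Fin n)).filter fun p => p.1 < p.2) = ∅ := by
    intro j; ext ⟨p, q⟩; simp; rintro rfl rfl; exact le_rfl
  rw [sum_knExponents_subset a b c B J hJB]
  have hc := card_eq_of_mem_iff B J hJB
  by_cases h0 : 0 ∈ B
  · have h1 : 1 ∉ B := fun h1 => h01 ⟨h0, h1⟩
    simp only [h0, h1, if_true, if_false] at hc ⊢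
    rw [hc]; push_cast
    rcases Nat.lt_or_ge J.card 2 with h2 | h2
    · obtain ⟨j, hj⟩ := Finset.card_eq_one.1 (show J.card = 1 by omega)
      rw [hj, hone]
      simpa using neg_lt_iff_pos_add.1 (hAa j)
    · linarith [hB J h2]
  · by_cases h1 : 1 ∈ B
    · simp only [h0, h1, if_true, if_false] at hc ⊢
      rw [hc]; push_cast
      rcases Nat.lt_or_ge J.card 2 with h2 | h2
      · obtain ⟨j, hj⟩ := Finset.card_eq_one.1 (show J.card = 1 by omega)
        rw [hj, hone]
        simpa using neg_lt_iff_pos_add.1 (hAb j)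
      · linarith [hC J h2]
    · simp only [h0, h1, if_false, zero_add] at hc ⊢
      rw [hc]
      rcases Nat.lt_or_ge J.card 3 with h2 | h2
      · obtain ⟨i, j, hij, hj⟩ := Finset.card_eq_two.1 (show J.card = 2 by omega)
        wlog hlt : i < j generalizing i j
        · exact this j i hij.symm (by rw [hj, Finset.pair_comm])
            (lt_of_le_of_ne (not_lt.1 hlt) hij.symm)
        have hf : (J ×ˢ J).filter (fun p => p.1 < p.2) = {(i, j)} := by
          rw [hj]
          ext ⟨p, q⟩
          simp only [Finset.mem_filter, Finset.mem_product, Finset.mem_insert,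
            Finset.mem_singleton, Prod.mk.injEq]
          constructor
          · rintro ⟨⟨rfl | rfl, rfl | rfl⟩, h⟩
            · exact absurd h (lt_irrefl _)
            · exact ⟨rfl, rfl⟩
            · exact absurd h hlt.not_gt
            · exact absurd h (lt_irrefl _)
          · rintro ⟨rfl, rfl⟩
            exact ⟨⟨Or.inl rfl, Or.inr rfl⟩, hlt⟩
        rw [hf, show J.card = 2 by omega]
        simp only [Finset.sum_singleton]
        push_cast
        linarith [hAc i j hlt]
      · linarith [hD J h2]

theorem escape_of_region {n : ℕ} {a b : Fin n → ℝ} {c : Fin n → Fin n → ℝ}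
    (hE : ∀ J : Finset (Fin n), J.Nonempty →
      (∑ j ∈ J, a j) + (∑ j ∈ J, b j) +
          (∑ i ∈ Jᶜ, ∑ j ∈ J, (if i < j then c i j else c j i)) +
          (∑ p ∈ (J ×ˢ J).filter (fun p => p.1 < p.2), c p.1 p.2) < -(J.card : ℝ))
    (B : Finset (Fin (n + 2))) (h0 : 0 ∈ B) (h1 : 1 ∈ B) (hB : B ≠ univ) :
    (∑ i, ∑ j, knExponents a b c i j) - (∑ i ∈ B, ∑ j ∈ B, knExponents a b c i j) +
      ((n : ℝ) + 2 - B.card) < 0 := by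
  set K : Finset (Fin n) := univ.filter fun j => j.succ.succ ∈ B with hK
  have hKB : ∀ j, j ∈ K ↔ j.succ.succ ∈ B := by simp [hK]
  have hne : Kᶜ.Nonempty := by
    rw [Finset.nonempty_iff_ne_empty, Ne, Finset.compl_eq_empty_iff]
    intro hu
    refine hB (Finset.eq_univ_iff_forall.2 fun i => ?_)
    refine Fin.cases h0 (fun i => Fin.cases h1 (fun i => ?_) i) i
    rw [← hKB, hu]
    exact Finset.mem_univ _
  have h := hE Kᶜ hne
  rw [compl_compl] at h
  have e1 := sum_knExponents_subset a b c univ univ (by simp)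
  have e2 := sum_knExponents_subset a b c B K hKB
  have hc := card_eq_of_mem_iff B K hKB
  have hcc : (K.card : ℝ) + Kᶜ.card = n := by
    have := Finset.card_add_card_compl K
    rw [Fintype.card_fin] at this
    exact_mod_cast this
  simp only [Finset.mem_univ, h0, h1, if_true, Finset.univ_product_univ] at e1 e2 hc
  rw [e1, e2, hc, sum_filter_lt_eq_add_compl c K, ← Finset.sum_add_sum_compl K a,
    ← Finset.sum_add_sum_compl K b]
  push_cast
  linarith

/-- The logarithm of the Koba-Nielsen integrand at `x`, as a linear functional of the exponents. -/
noncomputable def knLog {n : ℕ} (x : Fin n → ℝ) :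
    ((Fin n → ℂ) × (Fin n → ℂ) × (Fin n → Fin n → ℂ)) →L[ℂ] ℂ :=
  (∑ j, ((Real.log |x j| : ℝ) : ℂ) • (ContinuousLinearMap.proj (R := ℂ) (φ := fun _ : Fin n => ℂ) j ∘L
      ContinuousLinearMap.fst ℂ _ _)) +
  (∑ j, ((Real.log |1 - x j| : ℝ) : ℂ) •
    (ContinuousLinearMap.proj (R := ℂ) (φ := fun _ : Fin n => ℂ) j ∘L
      ContinuousLinearMap.fst ℂ _ _ ∘L ContinuousLinearMap.snd ℂ _ _)) +
  ∑ p ∈ univ.filter (fun p : Fin n × Fin n => p.1 < p.2),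
    ((Real.log |x p.1 - x p.2| : ℝ) : ℂ) •
      (ContinuousLinearMap.proj (R := ℂ) (φ := fun _ : Fin n => ℂ) p.2 ∘L
        ContinuousLinearMap.proj (R := ℂ) (φ := fun _ : Fin n => Fin n → ℂ) p.1 ∘L
        ContinuousLinearMap.snd ℂ _ _ ∘L ContinuousLinearMap.snd ℂ _ _)

theorem knLog_apply {n : ℕ} (x : Fin n → ℝ)
    (s : (Fin n → ℂ) × (Fin n → ℂ) × (Fin n → Fin n → ℂ)) :
    knLog x s = (∑ j, ((Real.log |x j| : ℝ) : ℂ) * s.1 j) +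
      (∑ j, ((Real.log |1 - x j| : ℝ) : ℂ) * s.2.1 j) +
      ∑ p ∈ univ.filter (fun p : Fin n × Fin n => p.1 < p.2),
        ((Real.log |x p.1 - x p.2| : ℝ) : ℂ) * s.2.2 p.1 p.2 := by
  simp [knLog]

theorem aestronglyMeasurable_knLog (n : ℕ) :
    AEStronglyMeasurable (knLog : (Fin n → ℝ) → _) volume := by
  unfold knLog
  refine AEStronglyMeasurable.add (AEStronglyMeasurable.add ?_ ?_) ?_ <;>
  · refine Finset.aestronglyMeasurable_fun_sum _ fun i _ => AEStronglyMeasurable.smul_const ?_ _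
    refine Measurable.aestronglyMeasurable ?_
    fun_prop

theorem knLog_re {n : ℕ} (x : Fin n → ℝ)
    (s : (Fin n → ℂ) × (Fin n → ℂ) × (Fin n → Fin n → ℂ)) :
    (knLog x s).re = ∑ i, ∑ j, knExponents (fun j => (s.1 j).re) (fun j => (s.2.1 j).re)
      (fun i j => (s.2.2 i j).re) i j * Real.log |knPoints x i - knPoints x j| := by
  rw [sum_knExponents_mul _ _ _ _ fun i j => by rw [abs_sub_comm], knLog_apply]
  simp [knPoints, mul_comm]

theorem exp_knLog {n : ℕ} {x : Fin n → ℝ} (hx : Function.Injective (knPoints x))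
    (s : (Fin n → ℂ) × (Fin n → ℂ) × (Fin n → Fin n → ℂ)) :
    Complex.exp (knLog x s) = (∏ j, ((|x j| : ℝ) : ℂ) ^ s.1 j) *
      (∏ j, ((|1 - x j| : ℝ) : ℂ) ^ s.2.1 j) *
      ∏ p ∈ univ.filter (fun p : Fin n × Fin n => p.1 < p.2),
        ((|x p.1 - x p.2| : ℝ) : ℂ) ^ s.2.2 p.1 p.2 := by
  have hpow : ∀ (d : ℝ) (z : ℂ), d ≠ 0 →
      ((|d| : ℝ) : ℂ) ^ z = Complex.exp (((Real.log |d| : ℝ) : ℂ) * z) := by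
    intro d z hd
    rw [Complex.cpow_def_of_ne_zero (by simpa using hd), Complex.ofReal_log (abs_nonneg d)]
  have h0 : ∀ j, x j ≠ 0 := fun j h => by
    have := @hx j.succ.succ 0 (by simpa [knPoints] using h)
    exact Fin.succ_ne_zero _ this
  have h1 : ∀ j, 1 - x j ≠ 0 := fun j h => by
    have := @hx (Fin.succ 0) j.succ.succ (by simpa [knPoints, sub_eq_zero] using h)
    exact Fin.succ_ne_zero _ (Fin.succ_injective _ this).symm
  have h2 : ∀ i j, i < j → x i - x j ≠ 0 := fun i j hij h => by
    have := @hx i.succ.succ j.succ.succ (by simpa [knPoints, sub_eq_zero] using h)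
    exact hij.ne (Fin.succ_injective _ (Fin.succ_injective _ this))
  rw [knLog_apply, Complex.exp_add, Complex.exp_add, Complex.exp_sum, Complex.exp_sum,
    Complex.exp_sum]
  congr 1
  · congr 1
    · exact prod_congr rfl fun j _ => (hpow _ _ (h0 j)).symm
    · exact prod_congr rfl fun j _ => (hpow _ _ (h1 j)).symm
  · exact prod_congr rfl fun p hp => (hpow _ _ (h2 _ _ (Finset.mem_filter.1 hp).2)).symm

/-- For `N ≥ 4`, the real Koba-Nielsen local zeta function converges and is holomorphic
on the region determined by the inequalities (A)–(E). -/
theorem kobaNielsen_real_exact_convergence_domain (N : ℕ) (hN : 4 ≤ N) :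
    (∀ s ∈ KNregionExact N, Integrable (KNintegrand N s.1 s.2.1 s.2.2)) ∧
    DifferentiableOn ℂ
      (fun s : (Fin (N - 3) → ℂ) × (Fin (N - 3) → ℂ) × (Fin (N - 3) → Fin (N - 3) → ℂ) =>
        ∫ x, KNintegrand N s.1 s.2.1 s.2.2 x)
      (KNregionExact N) := by
  have hae : ∀ s : (Fin (N - 3) → ℂ) × (Fin (N - 3) → ℂ) × (Fin (N - 3) → Fin (N - 3) → ℂ),
      (fun x => Complex.exp (knLog x s)) =ᵐ[volume] KNintegrand N s.1 s.2.1 s.2.2 := by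
    intro s
    filter_upwards [ae_injective_knPoints (N - 3)] with x hx
    exact exp_knLog hx s
  obtain ⟨h1, h2⟩ := differentiableOn_integral_exp (aestronglyMeasurable_knLog (N - 3))
    (U := KNregionExact N) (by
      rintro s₀ ⟨⟨hAa, hAb, hAc⟩, hB, hC, hD, hE⟩
      obtain ⟨ε, hε, A, r, hr, h⟩ := exists_uniform_margin
        (S := fun s : (Fin (N - 3) → ℂ) × (Fin (N - 3) → ℂ) × (Fin (N - 3) → Fin (N - 3) → ℂ) =>
          knExponents (fun j => (s.1 j).re) (fun j => (s.2.1 j).re) fun i j => (s.2.2 i j).re)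
        (continuous_knExponents (by fun_prop) (by fun_prop) (by fun_prop))
        (fun s => knExponents_diag _ _ _)
        (collide_of_region hAa hAb hAc hB hC hD) (escape_of_region hE)
      obtain ⟨bound, hb, hbound⟩ := exists_integrable_bound (N - 3) hε A
      refine ⟨r, hr, bound, hb, ?_⟩
      filter_upwards [hbound] with x hx s hs
      rw [knLog_re]
      exact hx _ (h s hs).1 (h s hs).2)
  refine ⟨fun s hs => (h1 s hs).congr (hae s), h2.congr fun s _ => ?_⟩
  exact (integral_congr_ae (hae s)).symm
end

section
/- Let N ≥ 4 be an integer. The complex Koba-Nielsen local zeta function Z_ℂ^(N)(s), defined with the normalized complex modulus |z|_ℂ = |z|², converges (i.e., the integrand is absolutely integrable over ℂ^{N-3}) and defines a holomorphic function of s on the open set of all s = (s_{ij}) ∈ ℂ^{N(N-3)/2} satisfying −2/(N−2) < Re(s_{ij}) < −2/N for every index pair ij. -/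
open MeasureTheory Finset

/-- The integrand of the complex Koba-Nielsen local zeta function `Z_ℂ^(N)(s)`, defined
with the normalized complex modulus `|z|_ℂ = |z|² = ‖z‖²`. The variables
`x 0, …, x (N-4)` represent `x_2, …, x_{N-2}`; `a j` is `s_{1,(j+2)}`,
`b j` is `s_{(N-1),(j+2)}`, and `c i j` (for `i < j`) is `s_{(i+2),(j+2)}`. -/
noncomputable def KNintegrandC (N : ℕ) (a b : Fin (N - 3) → ℂ)
    (c : Fin (N - 3) → Fin (N - 3) → ℂ) (x : Fin (N - 3) → ℂ) : ℂ :=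
  (∏ j, ((‖x j‖ ^ 2 : ℝ) : ℂ) ^ a j) * (∏ j, ((‖1 - x j‖ ^ 2 : ℝ) : ℂ) ^ b j) *
    ∏ p ∈ Finset.univ.filter (fun p : Fin (N - 3) × Fin (N - 3) => p.1 < p.2),
      ((‖x p.1 - x p.2‖ ^ 2 : ℝ) : ℂ) ^ c p.1 p.2

namespace KobaNielsen

/-- The radial profile `r ↦ r ^ (-p)` for `r ≤ 1` and `r ↦ r ^ (-q)` for `r ≥ 1`. -/
noncomputable def profile (p q r : ℝ) : ℝ := (min 1 r) ^ (-p) * (max 1 r) ^ (-q)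

lemma profile_nonneg (p q : ℝ) {r : ℝ} (hr : 0 ≤ r) : 0 ≤ profile p q r := by
  unfold profile; positivity

lemma integrable_profile_norm {p q : ℝ} (hp : p < 2) (hq : 2 < q) :
    Integrable (fun z : ℂ => profile p q ‖z‖) := by
  rw [integrable_fun_norm_addHaar volume, Complex.finrank_real_complex,
    ← Set.Ioc_union_Ioi_eq_Ioi zero_le_one]
  refine IntegrableOn.union ?_ ?_
  · have h : IntegrableOn (fun y : ℝ => y ^ (1 - p)) (Set.Ioc 0 1) :=
      (intervalIntegrable_iff_integrableOn_Ioc_of_le zero_le_one).1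
        (intervalIntegral.intervalIntegrable_rpow' (by linarith))
    refine h.congr_fun (fun y hy => ?_) measurableSet_Ioc
    simp only [profile, min_eq_right hy.2, max_eq_left hy.2, Real.one_rpow, smul_eq_mul]
    rw [sub_eq_add_neg, Real.rpow_add hy.1]
    simp
  · have h := integrableOn_Ioi_rpow_of_lt (a := 1 - q) (by linarith) zero_lt_one
    refine h.congr_fun (fun y hy => ?_) measurableSet_Ioi
    have hy1 : (1 : ℝ) < y := hy
    simp only [profile, min_eq_left hy1.le, max_eq_right hy1.le, Real.one_rpow, smul_eq_mul]
    rw [sub_eq_add_neg, Real.rpow_add (by linarith)]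
    simp

/-- A product of integrable functions of linear coordinates on `ℂ^n` is integrable. -/
lemma integrable_prod_comp_linearCoord {n : ℕ} {T : Type*} [Fintype T]
    (v : T → Module.Dual ℂ (Fin n → ℂ)) (hv : LinearIndependent ℂ v)
    (hspan : ⊤ ≤ Submodule.span ℂ (Set.range v)) (c : T → ℂ) {g : ℂ → ℝ}
    (hg : Integrable g) :
    Integrable (fun x : Fin n → ℂ => ∏ t, g (v t x - c t)) := by
  have hcard : Fintype.card T = n := by
    have h := Module.finrank_eq_card_basis (Module.Basis.mk hv hspan)
    rw [Subspace.dual_finrank_eq] at h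
    simpa using h.symm
  let L : (Fin n → ℂ) →ₗ[ℂ] (T → ℂ) := LinearMap.pi v
  have hinj : Function.Injective L := by
    rw [← LinearMap.ker_eq_bot, LinearMap.ker_eq_bot']
    intro x hx
    have hz : ∀ f : Module.Dual ℂ (Fin n → ℂ), f x = 0 := by
      intro f
      have hf : f ∈ Submodule.span ℂ (Set.range v) := hspan trivial
      induction hf using Submodule.span_induction with
      | mem f hf =>
        obtain ⟨t, rfl⟩ := hf
        exact congrFun hx t
      | zero => simp
      | add f g _ _ hf hg => simp [hf, hg]
      | smul a f _ hf => simp [hf]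
    exact funext fun i => hz (LinearMap.proj i)
  let e : (Fin n → ℂ) ≃L[ℝ] (T → ℂ) :=
    ((LinearEquiv.ofInjectiveOfFinrankEq L hinj (by simp [hcard])).restrictScalars
      ℝ).toContinuousLinearEquiv
  have hprod : Integrable (fun y : T → ℂ => ∏ t, g (y t - c t)) :=
    Integrable.fintype_prod fun t => hg.comp_sub_right (c t)
  have hmap : Integrable (fun y : T → ℂ => ∏ t, g (y t - c t))
      (Measure.map e (volume : Measure (Fin n → ℂ))) := by
    rw [Measure.isAddLeftInvariant_eq_smul (Measure.map e volume) (volume : Measure (T → ℂ))]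
    exact hprod.smul_measure_nnreal
  exact (integrable_map_equiv e.toHomeomorph.toMeasurableEquiv _).1 hmap

lemma prod_prod_ite_eq {n : ℕ} (a : Fin n → ℝ) (b : Fin n → Fin n → ℝ)
    (hb : ∀ i j, b i j = b j i) :
    ∏ c, ∏ j, (if j = c then a c else b j c) =
      (∏ j, a j) * (∏ p : Fin n × Fin n with p.1 < p.2, b p.1 p.2) ^ 2 := by
  rw [← Fintype.prod_prod_type' (f := fun c j : Fin n => if j = c then a c else b j c)]
  have hsplit : ∀ p : Fin n × Fin n, (if p.2 = p.1 then a p.1 else b p.2 p.1) =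
      (if p.2 = p.1 then a p.1 else 1) * ((if p.1 < p.2 then b p.1 p.2 else 1) *
        (if p.2 < p.1 then b p.2 p.1 else 1)) := by
    rintro ⟨i, j⟩
    rcases lt_trichotomy i j with h | h | h
    · simp [h, h.ne', h.not_gt, hb j i]
    · simp [h]
    · simp [h, h.ne, h.not_gt]
  rw [prod_congr rfl fun p _ => hsplit p, prod_mul_distrib, prod_mul_distrib, sq,
    prod_filter]
  congr 1
  · rw [Fintype.prod_prod_type]
    simp
  · congr 1
    exact (Equiv.prodComm _ _).prod_comp fun p : Fin n × Fin n => if p.1 < p.2 then b p.1 p.2 else 1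

/-- The weights of the star centred at a root (`none`) or at the vertex `c` (`some c`). -/
noncomputable def starWeight {n : ℕ} (a : Fin n → ℝ) (b : Fin n → Fin n → ℝ) :
    Option (Fin n) → Fin n → ℝ
  | none, j => a j
  | some c, j => if j = c then a c else b j c

lemma exists_star_pow_ge {n : ℕ} (m : ℕ) (a : Fin n → ℝ) (b : Fin n → Fin n → ℝ)
    (hb : ∀ i j, b i j = b j i) (ha0 : ∀ j, 0 ≤ a j) (hb0 : ∀ i j, 0 ≤ b i j) :
    ∃ k, (∏ j, a j) ^ (m + 2) * (∏ p : Fin n × Fin n with p.1 < p.2, b p.1 p.2) ^ 2 ≤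
      ∏ j, starWeight a b k j ^ (n + m + 1) := by
  obtain ⟨k, -, hk⟩ := (univ : Finset (Option (Fin n))).exists_max_image
    (fun k => ∏ j, starWeight a b k j) univ_nonempty
  have hnn : ∀ k, 0 ≤ ∏ j, starWeight a b k j := fun k => prod_nonneg fun j _ => by
    cases k with
    | none => exact ha0 j
    | some c => simp only [starWeight]; split_ifs <;> simp [ha0, hb0]
  refine ⟨k, ?_⟩
  calc _ = (∏ j, a j) ^ (m + 1) * ∏ c, ∏ j, starWeight a b (some c) j := by
        simp only [starWeight]
        rw [prod_prod_ite_eq a b hb]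
        ring
    _ ≤ (∏ j, starWeight a b k j) ^ (m + 1) * ∏ _c : Fin n, ∏ j, starWeight a b k j := by
        refine mul_le_mul (pow_le_pow_left₀ (hnn none) (hk none (mem_univ _)) _)
          (prod_le_prod (fun c _ => hnn (some c)) fun c _ => hk (some c) (mem_univ _))
          (prod_nonneg fun c _ => hnn (some c)) (pow_nonneg (hnn k) _)
    _ = _ := by
        rw [prod_const, card_univ, Fintype.card_fin, ← pow_add, prod_pow]
        congr 1
        omega

/-- The factors of the integrand: `inl (j, false)`, `inl (j, true)` and `inr (i, j)` stand for
`x j`, `x j - 1` and `x i - x j`. -/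
abbrev Edge (n : ℕ) := (Fin n × Bool) ⊕ (Fin n × Fin n)

/-- The `j`-th coordinate as a linear functional. -/
abbrev coord {n : ℕ} (j : Fin n) : Module.Dual ℂ (Fin n → ℂ) := LinearMap.proj j

/-- The linear part of the affine function attached to an edge. -/
noncomputable def dirForm {n : ℕ} : Edge n → Module.Dual ℂ (Fin n → ℂ)
  | .inl (j, _) => coord j
  | .inr (i, j) => coord i - coord j

/-- The constant subtracted in the affine function attached to an edge. -/
noncomputable def offset {n : ℕ} : Edge n → ℂ
  | .inl (_, true) => 1
  | _ => 0

/-- The length of an edge in the configuration `x`. -/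
noncomputable def len {n : ℕ} (x : Fin n → ℂ) (e : Edge n) : ℝ := ‖dirForm e x - offset e‖

@[simp] lemma len_inl_false {n : ℕ} (x : Fin n → ℂ) (j : Fin n) :
    len x (.inl (j, false)) = ‖x j‖ := by simp [len, dirForm, offset]

@[simp] lemma len_inl_true {n : ℕ} (x : Fin n → ℂ) (j : Fin n) :
    len x (.inl (j, true)) = ‖1 - x j‖ := by
  simp [len, dirForm, offset, norm_sub_rev]

@[simp] lemma len_inr {n : ℕ} (x : Fin n → ℂ) (p : Fin n × Fin n) :
    len x (.inr p) = ‖x p.1 - x p.2‖ := by simp [len, dirForm, offset]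

lemma len_nonneg {n : ℕ} (x : Fin n → ℂ) (e : Edge n) : 0 ≤ len x e := norm_nonneg _

/-- The edges of the star centred at the roots (`none`) or at the vertex `c` (`some c`), where
`ρ j` selects the root attached to `j`. -/
def star {n : ℕ} (ρ : Fin n → Bool) : Option (Fin n) → Fin n → Edge n
  | none, j => .inl (j, ρ j)
  | some c, j => if j = c then .inl (c, ρ c) else .inr (j, c)

lemma apply_star {n : ℕ} (f : Edge n → ℝ) (ρ : Fin n → Bool) (k : Option (Fin n)) (j : Fin n) :
    f (star ρ k j) =
      starWeight (fun j => f (.inl (j, ρ j))) (fun i j => f (.inr (i, j))) k j := by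
  cases k with
  | none => rfl
  | some c => simp only [star, starWeight]; split_ifs <;> rfl

lemma top_le_span_star {n : ℕ} (ρ : Fin n → Bool) (k : Option (Fin n)) :
    ⊤ ≤ Submodule.span ℂ (Set.range fun j => dirForm (star ρ k j)) := by
  set W := Submodule.span ℂ (Set.range fun j => dirForm (star ρ k j)) with hW
  have hmem : ∀ j, dirForm (star ρ k j) ∈ W := fun j => Submodule.subset_span ⟨j, rfl⟩
  have hproj : ∀ j, coord j ∈ W := by
    intro j
    cases k with
    | none => exact hmem j
    | some c =>
      have hc : coord c ∈ W := by
        simpa [star, dirForm] using hmem c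
      by_cases hj : j = c
      · rwa [hj]
      · have h : coord j - coord c ∈ W := by
          simpa [star, dirForm, hj] using hmem j
        simpa using W.add_mem h hc
  intro f _
  have hf : f = ∑ j, f (Pi.single j 1) • coord j := by
    refine LinearMap.pi_ext' fun i => LinearMap.ext_ring ?_
    simp [Pi.single_apply]
  rw [hf]
  exact W.sum_mem fun j _ => W.smul_mem _ (hproj j)

lemma linearIndependent_star {n : ℕ} (ρ : Fin n → Bool) (k : Option (Fin n)) :
    LinearIndependent ℂ fun j => dirForm (star ρ k j) :=
  linearIndependent_of_top_le_span_of_card_eq_finrank (top_le_span_star ρ k)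
    (by rw [Subspace.dual_finrank_eq]; simp)

/-- Two families of edges, the first independent and the second spanning, can be merged into a
basis which uses the edges of the first family lying in `S`. -/
lemma exists_basis_prod_le {n : ℕ} {s t : Fin n → Edge n}
    (hs : LinearIndependent ℂ fun j => dirForm (s j))
    (ht : LinearIndependent ℂ fun j => dirForm (t j))
    (htspan : ⊤ ≤ Submodule.span ℂ (Set.range fun j => dirForm (t j)))
    {u w g : Edge n → ℝ} (hu0 : ∀ e, 0 ≤ u e) (hw0 : ∀ e, 0 ≤ w e) (hw1 : ∀ e, w e ≤ 1)
    (hg0 : ∀ e, 0 ≤ g e) (hwg : ∀ j, w (t j) ≤ g (t j)) (hug : ∀ e, u e = 1 ∨ u e ≤ g e) :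
    ∃ T : Finset (Edge n), LinearIndepOn ℂ dirForm (T : Set (Edge n)) ∧
      ⊤ ≤ Submodule.span ℂ (dirForm '' (T : Set (Edge n))) ∧
      (∏ j, u (s j)) * ∏ j, w (t j) ≤ ∏ e ∈ T, g e := by
  classical
  have hsinj : Function.Injective s := fun i j h => hs.injective (by simp [h])
  have htinj : Function.Injective t := fun i j h => ht.injective (by simp [h])
  let S : Finset (Edge n) := (univ.image s).filter fun e => u e ≠ 1
  have hS : LinearIndepOn ℂ dirForm (S : Set (Edge n)) := by
    have h : LinearIndepOn ℂ dirForm (Set.range s) :=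
      (linearIndepOn_range_iff hsinj dirForm).2 hs
    exact h.mono fun e he => by
      obtain ⟨j, -, rfl⟩ := mem_image.1 (mem_filter.1 (mem_coe.1 he)).1
      exact ⟨j, rfl⟩
  obtain ⟨b, hb, hSb, hspan, hli⟩ :=
    exists_linearIndepOn_extension hS (t := (S : Set (Edge n)) ∪ Set.range t)
      Set.subset_union_left
  lift b to Finset (Edge n) using Set.toFinite b
  have hSb' : S ⊆ b := by exact_mod_cast hSb
  refine ⟨b, hli, htspan.trans (Submodule.span_le.2 ?_), ?_⟩
  · rintro _ ⟨j, rfl⟩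
    exact hspan ⟨t j, Or.inr ⟨j, rfl⟩, rfl⟩
  · have h1 : ∏ j, u (s j) = ∏ e ∈ S, u e := by
      rw [prod_filter_ne_one, prod_image fun i _ j _ h => hsinj h]
    have h2 : ∏ j, w (t j) = ∏ e ∈ univ.image t, w e := by
      rw [prod_image fun i _ j _ h => htinj h]
    have hsub : b \ S ⊆ univ.image t := by
      intro e he
      obtain ⟨heb, heS⟩ := mem_sdiff.1 he
      rcases hb heb with h | ⟨j, rfl⟩
      · exact absurd (mem_coe.1 h) heS
      · exact mem_image_of_mem t (mem_univ j)
    rw [h1, h2, ← prod_sdiff hSb', mul_comm (∏ e ∈ b \ S, g e)]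
    refine mul_le_mul (prod_le_prod (fun e _ => hu0 e) fun e he => ?_) ?_
      (prod_nonneg fun e _ => hw0 e) (prod_nonneg fun e _ => hg0 e)
    · exact (hug e).resolve_left (mem_filter.1 he).2
    · refine (prod_le_prod_of_subset_of_le_one hsub ?_ ?_).trans
        (prod_le_prod (fun e _ => hw0 e) fun e he => ?_)
      · exact fun e _ => hw0 e
      · exact fun e _ _ => hw1 e
      · obtain ⟨j, -, rfl⟩ := mem_image.1 (hsub he)
        exact hwg j

lemma rpow_min_mul_rpow_min_le {a d e : ℝ} (ha : 0 ≤ a) (he : 1 ≤ d + e) (hd : 0 < d)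
    (hde : d ≤ e) : (min 1 d) ^ (-a) * (min 1 e) ^ (-a) ≤ 2 ^ a * (min 1 d) ^ (-a) := by
  have h : (min 1 e) ^ (-a) ≤ (2 : ℝ) ^ a := by
    have h2 : (1 / 2 : ℝ) ≤ min 1 e := le_min (by norm_num) (by linarith)
    refine (Real.rpow_le_rpow_of_nonpos (by norm_num) h2 (by linarith)).trans_eq ?_
    rw [one_div, Real.inv_rpow (by norm_num), Real.rpow_neg (by norm_num), inv_inv]
  rw [mul_comm]
  exact mul_le_mul_of_nonneg_right h (by positivity)

lemma rpow_max_le {a d e : ℝ} (ha : 0 ≤ a) (hde : d ≤ e + 1) :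
    (max 1 e) ^ (-a) ≤ 2 ^ a * (max 1 d) ^ (-a) := by
  have h : max 1 d ≤ 2 * max 1 e := by
    have := le_max_left 1 e
    have := le_max_right 1 e
    exact max_le (by linarith) (by linarith)
  have h0 : (0 : ℝ) < max 1 d := by positivity
  have := Real.rpow_le_rpow_of_nonpos h0 h (by linarith : -a ≤ 0)
  rw [Real.mul_rpow (by norm_num) (by positivity), Real.rpow_neg (by norm_num)] at this
  have h2 : (0 : ℝ) < 2 ^ a := by positivity
  rwa [← div_eq_inv_mul, div_le_iff₀' h2] at this

lemma len_star_pos {n : ℕ} {x : Fin n → ℂ} (h0 : ∀ j, x j ≠ 0) (h1 : ∀ j, x j ≠ 1)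
    (hx : Function.Injective x) (ρ : Fin n → Bool) (k : Option (Fin n)) (j : Fin n) :
    0 < len x (star ρ k j) := by
  have hroot : ∀ i, 0 < len x (.inl (i, ρ i)) := by
    intro i
    cases ρ i
    · simpa using h0 i
    · simpa [sub_eq_zero] using (h1 i).symm
  cases k with
  | none => exact hroot j
  | some c =>
    by_cases hj : j = c
    · simpa [star, hj] using hroot c
    · simpa [star, hj, sub_eq_zero] using hx.ne hj

/-- Away from the coincidence locus, the product of all profiles is controlled by a product over
a basis of edges. -/
lemma exists_basis_bound {n : ℕ} {a b : ℝ} (ha : 0 ≤ a) (hb : 0 ≤ b) {x : Fin n → ℂ}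
    (h0 : ∀ j, x j ≠ 0) (h1 : ∀ j, x j ≠ 1) (hx : Function.Injective x) :
    ∃ T : Finset (Edge n), LinearIndepOn ℂ dirForm (T : Set (Edge n)) ∧
      ⊤ ≤ Submodule.span ℂ (dirForm '' (T : Set (Edge n))) ∧
      (∏ j, profile (2 * a) (2 * b) ‖x j‖) * (∏ j, profile (2 * a) (2 * b) ‖1 - x j‖) *
        ∏ p : Fin n × Fin n with p.1 < p.2, profile (2 * a) (2 * b) ‖x p.1 - x p.2‖ ≤
      ((2 ^ (2 * a)) ^ n * (2 ^ (2 * b)) ^ n) *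
        ∏ e ∈ T, profile (a * (n + 1)) (b * (n + 3)) (len x e) := by
  let near : ℝ → ℝ := fun r => (min 1 r) ^ (-(2 * a))
  let far : ℝ → ℝ := fun r => (max 1 r) ^ (-(2 * b))
  have hnear0 : ∀ {r}, 0 ≤ r → 0 ≤ near r := fun hr => by positivity
  have hfar0 : ∀ r, 0 ≤ far r := fun r => by positivity
  have hfar1 : ∀ r, far r ≤ 1 := fun r =>
    Real.rpow_le_one_of_one_le_of_nonpos (le_max_left _ _) (by linarith)
  let ρ : Fin n → Bool := fun j => decide (‖1 - x j‖ ≤ ‖x j‖)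
  let σ : Fin n → Bool := fun _ => false
  have htri : ∀ j, 1 ≤ ‖x j‖ + ‖1 - x j‖ := fun j => by
    simpa using norm_add_le (x j) (1 - x j)
  have hnear : ∀ j, near ‖x j‖ * near ‖1 - x j‖ ≤
      2 ^ (2 * a) * near (len x (.inl (j, ρ j))) := by
    intro j
    by_cases h : ‖1 - x j‖ ≤ ‖x j‖
    · have hρ : ρ j = true := decide_eq_true h
      rw [hρ, len_inl_true, mul_comm (near _)]
      refine rpow_min_mul_rpow_min_le (by linarith) (by linarith [htri j]) ?_ h
      simpa [sub_eq_zero] using (h1 j).symm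
    · have hρ : ρ j = false := decide_eq_false h
      rw [hρ, len_inl_false]
      exact rpow_min_mul_rpow_min_le (by linarith) (htri j) (by simpa using h0 j)
        (le_of_not_ge h)
  have hfar : ∀ j, far ‖x j‖ * far ‖1 - x j‖ ≤
      2 ^ (2 * b) * far (len x (.inl (j, σ j))) ^ 2 := by
    intro j
    rw [len_inl_false, sq, mul_comm, ← mul_assoc]
    refine mul_le_mul_of_nonneg_right (rpow_max_le (by linarith) ?_) (hfar0 _)
    have := norm_sub_le (1 : ℂ) (1 - x j)
    rw [sub_sub_cancel, norm_one] at this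
    linarith
  have hsymm : ∀ i j, len x (.inr (i, j)) = len x (.inr (j, i)) := fun i j => by
    simp [norm_sub_rev]
  obtain ⟨k, hk⟩ := exists_star_pow_ge 0 (fun j => near (len x (.inl (j, ρ j))))
    (fun i j => near (len x (.inr (i, j)))) (fun i j => by rw [hsymm])
    (fun j => hnear0 (len_nonneg _ _)) (fun i j => hnear0 (len_nonneg _ _))
  obtain ⟨l, hl⟩ := exists_star_pow_ge 2 (fun j => far (len x (.inl (j, σ j))))
    (fun i j => far (len x (.inr (i, j)))) (fun i j => by rw [hsymm])
    (fun j => hfar0 _) (fun i j => hfar0 _)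
  simp only [← apply_star (fun e => near (len x e)) ρ, ← apply_star (fun e => far (len x e)) σ]
    at hk hl
  have hwg : ∀ j, far (len x (star σ l j)) ^ (n + 2 + 1) ≤
      profile (a * (n + 1)) (b * (n + 3)) (len x (star σ l j)) ^ 2 := by
    intro j
    have hr := len_star_pos h0 h1 hx σ l j
    set r := len x (star σ l j)
    have hmin : (1 : ℝ) ≤ (min 1 r) ^ (-(a * (n + 1))) :=
      Real.one_le_rpow_of_pos_of_le_one_of_nonpos (by positivity) (min_le_left _ _)
        (by have : 0 ≤ a * (n + 1) := by positivity
            linarith)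
    have hfarpow : far r ^ (n + 2 + 1) = ((max 1 r) ^ (-(b * (n + 3)))) ^ 2 := by
      simp only [far]
      rw [← Real.rpow_mul_natCast (by positivity), ← Real.rpow_mul_natCast (by positivity)]
      congr 1
      push_cast
      ring
    change far r ^ (n + 2 + 1) ≤ profile (a * (n + 1)) (b * (n + 3)) r ^ 2
    rw [hfarpow, profile]
    exact pow_le_pow_left₀ (by positivity) (le_mul_of_one_le_left (by positivity) hmin) 2
  have hug : ∀ e, near (len x e) ^ (n + 0 + 1) = 1 ∨
      near (len x e) ^ (n + 0 + 1) ≤ profile (a * (n + 1)) (b * (n + 3)) (len x e) ^ 2 := by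
    intro e
    have hr := len_nonneg x e
    set r := len x e
    rcases le_total 1 r with h | h
    · left
      simp [near, min_eq_left h]
    · right
      simp only [near, profile, min_eq_right h, max_eq_left h, Real.one_rpow, mul_one]
      rw [← Real.rpow_mul_natCast hr, ← Real.rpow_mul_natCast hr]
      refine (congrArg _ ?_).le
      push_cast
      ring
  obtain ⟨T, hT, hTspan, hle⟩ := exists_basis_prod_le (linearIndependent_star ρ k)
    (linearIndependent_star σ l) (top_le_span_star σ l)
    (u := fun e => near (len x e) ^ (n + 0 + 1)) (w := fun e => far (len x e) ^ (n + 2 + 1))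
    (g := fun e => profile (a * (n + 1)) (b * (n + 3)) (len x e) ^ 2)
    (fun e => pow_nonneg (hnear0 (len_nonneg _ _)) _) (fun e => pow_nonneg (hfar0 _) _)
    (fun e => pow_le_one₀ (hfar0 _) (hfar1 _)) (fun e => sq_nonneg _)
    hwg hug
  refine ⟨T, hT, hTspan, ?_⟩
  set A := ∏ j, near (len x (.inl (j, ρ j)))
  set B := ∏ p : Fin n × Fin n with p.1 < p.2, near (len x (.inr (p.1, p.2)))
  set A' := ∏ j, far (len x (.inl (j, σ j)))
  set B' := ∏ p : Fin n × Fin n with p.1 < p.2, far (len x (.inr (p.1, p.2)))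
  set P := ∏ e ∈ T, profile (a * (n + 1)) (b * (n + 3)) (len x e)
  have hA : 0 ≤ A := prod_nonneg fun j _ => hnear0 (len_nonneg _ _)
  have hB : 0 ≤ B := prod_nonneg fun p _ => hnear0 (len_nonneg _ _)
  have hA' : 0 ≤ A' := prod_nonneg fun j _ => hfar0 _
  have hB' : 0 ≤ B' := prod_nonneg fun p _ => hfar0 _
  have hP : 0 ≤ P := prod_nonneg fun e _ => profile_nonneg _ _ (len_nonneg _ _)
  have hsq : (A * B * (A' ^ 2 * B')) ^ 2 ≤ P ^ 2 := by
    calc _ = (A ^ (0 + 2) * B ^ 2) * (A' ^ (2 + 2) * B' ^ 2) := by ring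
      _ ≤ _ := mul_le_mul hk hl (by positivity) (prod_nonneg fun j _ =>
        pow_nonneg (hnear0 (len_nonneg _ _)) _)
      _ ≤ P ^ 2 := by simpa only [prod_pow] using hle
  have hABP : A * B * (A' ^ 2 * B') ≤ P :=
    (pow_le_pow_iff_left₀ (by positivity) hP two_ne_zero).1 hsq
  have hroots : (∏ j, near ‖x j‖ * near ‖1 - x j‖) ≤ (2 ^ (2 * a)) ^ n * A := by
    calc _ ≤ ∏ j, 2 ^ (2 * a) * near (len x (.inl (j, ρ j))) :=
          prod_le_prod (fun j _ => mul_nonneg (hnear0 (norm_nonneg _)) (hnear0 (norm_nonneg _)))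
            fun j _ => hnear j
      _ = _ := by simp [prod_mul_distrib, A]
  have hroots' : (∏ j, far ‖x j‖ * far ‖1 - x j‖) ≤ (2 ^ (2 * b)) ^ n * A' ^ 2 := by
    calc _ ≤ ∏ j, 2 ^ (2 * b) * far (len x (.inl (j, σ j))) ^ 2 :=
          prod_le_prod (fun j _ => mul_nonneg (hfar0 _) (hfar0 _)) fun j _ => hfar j
      _ = _ := by simp [prod_mul_distrib, prod_pow, A']
  calc _ = ((∏ j, near ‖x j‖ * near ‖1 - x j‖) * B) *
        ((∏ j, far ‖x j‖ * far ‖1 - x j‖) * B') := by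
        simp only [profile, prod_mul_distrib, B, B', near, far, len_inr]
        ring
    _ ≤ ((2 ^ (2 * a)) ^ n * A * B) * ((2 ^ (2 * b)) ^ n * A' ^ 2 * B') := by
        refine mul_le_mul (mul_le_mul_of_nonneg_right hroots hB)
          (mul_le_mul_of_nonneg_right hroots' hB') ?_ (by positivity)
        exact mul_nonneg (prod_nonneg fun j _ => mul_nonneg (hfar0 _) (hfar0 _)) hB'
    _ = ((2 ^ (2 * a)) ^ n * (2 ^ (2 * b)) ^ n) * (A * B * (A' ^ 2 * B')) := by ring
    _ ≤ _ := mul_le_mul_of_nonneg_left hABP (by positivity)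

open Classical in
/-- The sum over all bases of edges of the products of the corresponding profiles. -/
noncomputable def majorant {n : ℕ} (p q : ℝ) (x : Fin n → ℂ) : ℝ :=
  ∑ T ∈ univ.filter (fun T : Finset (Edge n) => LinearIndepOn ℂ dirForm (T : Set (Edge n)) ∧
    ⊤ ≤ Submodule.span ℂ (dirForm '' (T : Set (Edge n)))), ∏ e ∈ T, profile p q (len x e)

lemma prod_profile_nonneg {n : ℕ} (p q : ℝ) (x : Fin n → ℂ) (T : Finset (Edge n)) :
    0 ≤ ∏ e ∈ T, profile p q (len x e) :=
  prod_nonneg fun _ _ => profile_nonneg _ _ (len_nonneg _ _)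

lemma majorant_nonneg {n : ℕ} (p q : ℝ) (x : Fin n → ℂ) : 0 ≤ majorant p q x :=
  sum_nonneg fun T _ => prod_profile_nonneg p q x T

lemma integrable_majorant {n : ℕ} {p q : ℝ} (hp : p < 2) (hq : 2 < q) :
    Integrable (majorant p q : (Fin n → ℂ) → ℝ) := by
  classical
  refine integrable_finsetSum _ fun T hT => ?_
  obtain ⟨hli, hspan⟩ := (mem_filter.1 hT).2
  have h := integrable_prod_comp_linearCoord (fun e : (T : Set (Edge n)) => dirForm e.1) hli
    (by rwa [Set.image_eq_range] at hspan) (fun e => offset e.1)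
    (integrable_profile_norm hp hq)
  refine h.congr (Filter.Eventually.of_forall fun x => ?_)
  exact prod_coe_sort T fun e => profile p q (len x e)

lemma norm_sq_cpow_le {a b r : ℝ} {s : ℂ} (hr : 0 ≤ r) (hb : 0 < b) (ha : -a < s.re)
    (hs : s.re < -b) : ‖((r ^ 2 : ℝ) : ℂ) ^ s‖ ≤ profile (2 * a) (2 * b) r := by
  rcases hr.eq_or_lt with rfl | hr
  · have hs0 : s ≠ 0 := fun h => by simp [h] at hs; linarith
    simpa [Complex.zero_cpow hs0] using profile_nonneg (2 * a) (2 * b) le_rfl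
  · rw [Complex.norm_cpow_eq_rpow_re_of_pos (by positivity), ← Real.rpow_natCast_mul hr.le]
    have hr' : r = min 1 r * max 1 r := by rw [min_mul_max, one_mul]
    nth_rewrite 1 [hr']
    rw [Real.mul_rpow (by positivity) (by positivity), profile]
    push_cast
    refine mul_le_mul ?_ ?_ (by positivity) (by positivity)
    · exact Real.rpow_le_rpow_of_exponent_ge (by positivity) (min_le_left _ _) (by linarith)
    · exact Real.rpow_le_rpow_of_exponent_le (le_max_left _ _) (by linarith)

/-- The space of the parameters `s`. -/
abbrev Param (N : ℕ) :=
  (Fin (N - 3) → ℂ) × (Fin (N - 3) → ℂ) × (Fin (N - 3) → Fin (N - 3) → ℂ)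

lemma isOpen_KNregion (N : ℕ) (lo hi : ℝ) : IsOpen (KNregion N lo hi) := by
  have hband : ∀ f : Param N → ℂ, Continuous f →
      IsOpen {s | lo < (f s).re ∧ (f s).re < hi} := fun f hf =>
    (isOpen_lt continuous_const (Complex.continuous_re.comp hf)).inter
      (isOpen_lt (Complex.continuous_re.comp hf) continuous_const)
  have h1 := isOpen_iInter_of_finite fun j => hband (fun s => s.1 j) (by fun_prop)
  have h2 := isOpen_iInter_of_finite fun j => hband (fun s => s.2.1 j) (by fun_prop)
  have h3 := isOpen_iInter_of_finite fun i => isOpen_iInter_of_finite fun j =>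
    isOpen_iInter_of_finite fun _ : i < j => hband (fun s => s.2.2 i j) (by fun_prop)
  convert! h1.inter (h2.inter h3) using 1
  ext s
  simp [KNregion]

lemma exists_mem_KNregion_shrink {N : ℕ} {lo hi : ℝ} {s : Param N} (hs : s ∈ KNregion N lo hi) :
    ∃ lo' hi', lo < lo' ∧ hi' < hi ∧ s ∈ KNregion N lo' hi' := by
  obtain ⟨h1, h2, h3⟩ := hs
  have hlo : ∀ t, lo < t → ∀ᶠ l in nhdsWithin lo (Set.Ioi lo), l < t := fun t ht =>
    (eventually_lt_nhds ht).filter_mono nhdsWithin_le_nhds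
  have hhi : ∀ t, t < hi → ∀ᶠ l in nhdsWithin hi (Set.Iio hi), t < l := fun t ht =>
    (eventually_gt_nhds ht).filter_mono nhdsWithin_le_nhds
  obtain ⟨l, hl, l1, l2, l3⟩ := (eventually_mem_nhdsWithin.and
    ((Filter.eventually_all.2 fun j => hlo _ (h1 j).1).and
    ((Filter.eventually_all.2 fun j => hlo _ (h2 j).1).and
    (Filter.eventually_all.2 fun i => Filter.eventually_all.2 fun j =>
      Filter.eventually_all.2 fun h : i < j => hlo _ (h3 i j h).1)))).exists
  obtain ⟨u, hu, u1, u2, u3⟩ := (eventually_mem_nhdsWithin.and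
    ((Filter.eventually_all.2 fun j => hhi _ (h1 j).2).and
    ((Filter.eventually_all.2 fun j => hhi _ (h2 j).2).and
    (Filter.eventually_all.2 fun i => Filter.eventually_all.2 fun j =>
      Filter.eventually_all.2 fun h : i < j => hhi _ (h3 i j h).2)))).exists
  exact ⟨l, u, hl, hu, fun j => ⟨l1 j, u1 j⟩, fun j => ⟨l2 j, u2 j⟩,
    fun i j h => ⟨l3 i j h, u3 i j h⟩⟩

/-- All factors of the integrand are nonzero at `x`. -/
def Nondegenerate {n : ℕ} (x : Fin n → ℂ) : Prop :=
  (∀ j, x j ≠ 0) ∧ (∀ j, x j ≠ 1) ∧ Function.Injective x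

lemma KNintegrandC_eq_zero {N : ℕ} {lo : ℝ} {s : Param N} (hs : s ∈ KNregion N lo 0)
    {x : Fin (N - 3) → ℂ} (hx : ¬ Nondegenerate x) :
    KNintegrandC N s.1 s.2.1 s.2.2 x = 0 := by
  obtain ⟨h1, h2, h3⟩ := hs
  have hcpow : ∀ z t : ℂ, t.re < 0 → z = 0 → ((‖z‖ ^ 2 : ℝ) : ℂ) ^ t = 0 := by
    rintro _ t ht rfl
    have : t ≠ 0 := fun h => by simp [h] at ht
    simp [this]
  have hpair : ∀ i j, i < j → x i = x j → KNintegrandC N s.1 s.2.1 s.2.2 x = 0 := by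
    intro i j hij h
    refine mul_eq_zero_of_right _ (prod_eq_zero (i := (i, j)) (by simpa using hij) ?_)
    exact hcpow _ _ (h3 i j hij).2 (sub_eq_zero.2 h)
  simp only [Nondegenerate, not_and_or, not_forall, not_not, Function.Injective] at hx
  rcases hx with ⟨j, hj⟩ | ⟨j, hj⟩ | ⟨i, j, h, hij⟩
  · refine mul_eq_zero_of_left (mul_eq_zero_of_left (prod_eq_zero (mem_univ j) ?_) _) _
    exact hcpow _ _ (h1 j).2 hj
  · refine mul_eq_zero_of_left (mul_eq_zero_of_right _ (prod_eq_zero (mem_univ j) ?_)) _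
    exact hcpow _ _ (h2 j).2 (sub_eq_zero.2 hj.symm)
  · rcases lt_or_gt_of_ne hij with hlt | hlt
    · exact hpair i j hlt h
    · exact hpair j i hlt h.symm

/-- The logarithm of the integrand as a linear form in the parameters. -/
noncomputable def logForm (N : ℕ) (x : Fin (N - 3) → ℂ) : Param N →L[ℂ] ℂ :=
  (∑ j, Complex.log (‖x j‖ ^ 2 : ℝ) •
      (ContinuousLinearMap.proj (R := ℂ) (φ := fun _ : Fin (N - 3) => ℂ) j ∘L
        ContinuousLinearMap.fst ℂ _ _)) +
  (∑ j, Complex.log (‖1 - x j‖ ^ 2 : ℝ) •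
      (ContinuousLinearMap.proj (R := ℂ) (φ := fun _ : Fin (N - 3) => ℂ) j ∘L
        ContinuousLinearMap.fst ℂ _ _ ∘L ContinuousLinearMap.snd ℂ _ _)) +
  ∑ p : Fin (N - 3) × Fin (N - 3) with p.1 < p.2, Complex.log (‖x p.1 - x p.2‖ ^ 2 : ℝ) •
      (ContinuousLinearMap.proj (R := ℂ) (φ := fun _ : Fin (N - 3) => ℂ) p.2 ∘L
        ContinuousLinearMap.proj (R := ℂ) (φ := fun _ : Fin (N - 3) => Fin (N - 3) → ℂ) p.1 ∘L
        ContinuousLinearMap.snd ℂ _ _ ∘L ContinuousLinearMap.snd ℂ _ _)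

lemma KNintegrandC_eq_exp {N : ℕ} (s : Param N) {x : Fin (N - 3) → ℂ} (hx : Nondegenerate x) :
    KNintegrandC N s.1 s.2.1 s.2.2 x = Complex.exp (logForm N x s) := by
  obtain ⟨h0, h1, hinj⟩ := hx
  have hne : ∀ z : ℂ, z ≠ 0 → ((‖z‖ ^ 2 : ℝ) : ℂ) ≠ 0 := fun z hz => by simpa using hz
  simp only [logForm, _root_.add_apply, _root_.sum_apply,
    Complex.exp_add, Complex.exp_sum, KNintegrandC]
  congr 1
  · congr 1
    · exact prod_congr rfl fun j _ => Complex.cpow_def_of_ne_zero (hne _ (h0 j)) _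
    · exact prod_congr rfl fun j _ =>
        Complex.cpow_def_of_ne_zero (hne _ (sub_ne_zero.2 (h1 j).symm)) _
  · exact prod_congr rfl fun p hp => Complex.cpow_def_of_ne_zero
      (hne _ (sub_ne_zero.2 (hinj.ne (mem_filter.1 hp).2.ne))) _

lemma measurable_KNintegrandC {N : ℕ} (s : Param N) :
    Measurable (KNintegrandC N s.1 s.2.1 s.2.2) := by
  unfold KNintegrandC
  fun_prop

lemma measurable_logForm (N : ℕ) : Measurable (logForm N) := by
  unfold logForm
  refine (Measurable.add ?_ ?_).add ?_ <;>
    exact Finset.measurable_fun_sum _ fun _ _ => Measurable.smul_const (by fun_prop) _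

lemma hasFDerivAt_KNintegrandC {N : ℕ} {lo : ℝ} {s : Param N} (hs : s ∈ KNregion N lo 0)
    (x : Fin (N - 3) → ℂ) :
    HasFDerivAt (fun s : Param N => KNintegrandC N s.1 s.2.1 s.2.2 x)
      (KNintegrandC N s.1 s.2.1 s.2.2 x • logForm N x) s := by
  by_cases hx : Nondegenerate x
  · simp only [KNintegrandC_eq_exp _ hx]
    exact (logForm N x).hasFDerivAt.cexp
  · rw [KNintegrandC_eq_zero hs hx]
    refine HasFDerivAt.congr_fderiv ?_ (zero_smul ℂ (logForm N x)).symm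
    refine (hasFDerivAt_const (0 : ℂ) s).congr_of_eventuallyEq ?_
    filter_upwards [(isOpen_KNregion N lo 0).mem_nhds hs] with t ht
    exact KNintegrandC_eq_zero ht hx

lemma KNregion_mono {N : ℕ} {lo hi hi' : ℝ} (h : hi ≤ hi') :
    KNregion N lo hi ⊆ KNregion N lo hi' := fun _ ⟨h1, h2, h3⟩ =>
  ⟨fun j => ⟨(h1 j).1, (h1 j).2.trans_le h⟩, fun j => ⟨(h2 j).1, (h2 j).2.trans_le h⟩,
    fun i j hij => ⟨(h3 i j hij).1, (h3 i j hij).2.trans_le h⟩⟩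

lemma exists_norm_KNintegrandC_le (N : ℕ) {a b : ℝ} (ha : 0 ≤ a) (hb : 0 < b) :
    ∃ C, 0 ≤ C ∧ ∀ s ∈ KNregion N (-a) (-b), ∀ x,
      ‖KNintegrandC N s.1 s.2.1 s.2.2 x‖ ≤
        C * majorant (a * ((N - 3 : ℕ) + 1)) (b * ((N - 3 : ℕ) + 3)) x := by
  classical
  refine ⟨(2 ^ (2 * a)) ^ (N - 3) * (2 ^ (2 * b)) ^ (N - 3), by positivity, fun s hs x => ?_⟩
  by_cases hx : Nondegenerate x
  · obtain ⟨h1, h2, h3⟩ := hs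
    obtain ⟨T, hT, hTspan, hle⟩ := exists_basis_bound ha hb.le hx.1 hx.2.1 hx.2.2
    refine le_trans ?_ (hle.trans (mul_le_mul_of_nonneg_left ?_ (by positivity)))
    · have hpr : ∀ z : ℂ, 0 ≤ profile (2 * a) (2 * b) ‖z‖ := fun z =>
        profile_nonneg _ _ (norm_nonneg z)
      simp only [KNintegrandC, norm_mul, norm_prod]
      refine mul_le_mul (mul_le_mul ?_ ?_ ?_ ?_) ?_ ?_ ?_
      · exact prod_le_prod (fun _ _ => norm_nonneg _) fun j _ =>
          norm_sq_cpow_le (norm_nonneg _) hb (h1 j).1 (h1 j).2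
      · exact prod_le_prod (fun _ _ => norm_nonneg _) fun j _ =>
          norm_sq_cpow_le (norm_nonneg _) hb (h2 j).1 (h2 j).2
      · exact prod_nonneg fun _ _ => norm_nonneg _
      · exact prod_nonneg fun _ _ => hpr _
      · refine prod_le_prod (fun _ _ => norm_nonneg _) fun p hp => ?_
        have h := h3 p.1 p.2 (mem_filter.1 hp).2
        exact norm_sq_cpow_le (norm_nonneg _) hb h.1 h.2
      · exact prod_nonneg fun _ _ => norm_nonneg _
      · exact mul_nonneg (prod_nonneg fun _ _ => hpr _) (prod_nonneg fun _ _ => hpr _)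
    · exact single_le_sum (f := fun T : Finset (Edge (N - 3)) => ∏ e ∈ T,
        profile (a * ((N - 3 : ℕ) + 1)) (b * ((N - 3 : ℕ) + 3)) (len x e))
        (fun T _ => prod_profile_nonneg _ _ x T) (mem_filter.2 ⟨mem_univ T, hT, hTspan⟩)
  · rw [KNintegrandC_eq_zero (KNregion_mono (by linarith) hs) hx, norm_zero]
    exact mul_nonneg (by positivity) (majorant_nonneg _ _ _)

lemma integrable_and_differentiableAt {N : ℕ} {a b : ℝ} (ha : 0 ≤ a) (hb : 0 < b)
    (ha2 : a * ((N - 3 : ℕ) + 1) < 2) (hb2 : 2 < b * ((N - 3 : ℕ) + 3)) {s : Param N}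
    (hs : s ∈ KNregion N (-a) (-b)) :
    Integrable (KNintegrandC N s.1 s.2.1 s.2.2) ∧
      DifferentiableAt ℂ (fun s : Param N => ∫ x, KNintegrandC N s.1 s.2.1 s.2.2 x) s := by
  obtain ⟨C, hC, hbound⟩ := exists_norm_KNintegrandC_le N ha hb
  set M : (Fin (N - 3) → ℂ) → ℝ :=
    fun x => C * majorant (a * ((N - 3 : ℕ) + 1)) (b * ((N - 3 : ℕ) + 3)) x
  have hM : Integrable M := (integrable_majorant ha2 hb2).const_mul C
  have hint : ∀ t ∈ KNregion N (-a) (-b), Integrable (KNintegrandC N t.1 t.2.1 t.2.2) :=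
    fun t ht => hM.mono' (measurable_KNintegrandC t).aestronglyMeasurable
      (Filter.Eventually.of_forall (hbound t ht))
  refine ⟨hint s hs, ?_⟩
  obtain ⟨ε, hε, hball⟩ := Metric.isOpen_iff.1 (isOpen_KNregion N (-a) (-b)) s hs
  have hsub : ∀ t ∈ Metric.ball s (ε / 2), Metric.ball t (ε / 2) ⊆ KNregion N (-a) (-b) :=
    fun t ht => (Metric.ball_subset_ball' (by
      have := Metric.mem_ball.1 ht
      linarith)).trans hball
  have hderiv : ∀ t ∈ KNregion N (-a) (-b), ∀ x, HasFDerivAt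
      (fun s : Param N => KNintegrandC N s.1 s.2.1 s.2.2 x)
      (KNintegrandC N t.1 t.2.1 t.2.2 x • logForm N x) t := fun t ht x =>
    hasFDerivAt_KNintegrandC (KNregion_mono (by linarith) ht) x
  refine (hasFDerivAt_integral_of_dominated_of_fderiv_le (𝕜 := ℂ)
    (F := fun (s : Param N) x => KNintegrandC N s.1 s.2.1 s.2.2 x)
    (F' := fun (s : Param N) x => KNintegrandC N s.1 s.2.1 s.2.2 x • logForm N x)
    (bound := fun x => 2 * M x / (ε / 2)) (Metric.ball_mem_nhds s (half_pos hε))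
    (Filter.Eventually.of_forall fun t => (measurable_KNintegrandC t).aestronglyMeasurable)
    (hint s hs) ?_ ?_ ?_ ?_).differentiableAt
  · exact ((measurable_KNintegrandC s).smul (measurable_logForm N)).aestronglyMeasurable
  · refine Filter.Eventually.of_forall fun x t ht => ?_
    have htR := hsub t ht (Metric.mem_ball_self (half_pos hε))
    rw [← (hderiv t htR x).fderiv]
    refine Complex.norm_fderiv_le_div_of_mapsTo_ball (fun u hu =>
      (hderiv u (hsub t ht hu) x).differentiableAt.differentiableWithinAt) (fun u hu => ?_)
      (half_pos hε)
    rw [Metric.mem_closedBall, dist_eq_norm, two_mul]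
    exact (norm_sub_le _ _).trans (add_le_add (hbound u (hsub t ht hu) x) (hbound t htR x))
  · exact (hM.const_mul 2).div_const _
  · exact Filter.Eventually.of_forall fun x t ht =>
      hderiv t (hsub t ht (Metric.mem_ball_self (half_pos hε))) x

lemma integrable_and_differentiableAt_of_mem {N : ℕ} (hN : 4 ≤ N) {s : Param N}
    (hs : s ∈ KNregion N (-2 / ((N : ℝ) - 2)) (-2 / (N : ℝ))) :
    Integrable (KNintegrandC N s.1 s.2.1 s.2.2) ∧
      DifferentiableAt ℂ (fun s : Param N => ∫ x, KNintegrandC N s.1 s.2.1 s.2.2 x) s := by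
  obtain ⟨lo, hi, hlo, hhi, hmem⟩ := exists_mem_KNregion_shrink hs
  have hN' : (4 : ℝ) ≤ N := by exact_mod_cast hN
  have hcast : ((N - 3 : ℕ) : ℝ) = N - 3 := by
    rw [Nat.cast_sub (by omega)]
    norm_num
  have hhi0 : hi < 0 := hhi.trans_le (div_nonpos_of_nonpos_of_nonneg (by norm_num) (by linarith))
  have hlo0 : lo < 0 := by
    have h := hmem.1 ⟨0, by omega⟩
    linarith [h.1, h.2]
  refine integrable_and_differentiableAt (a := -lo) (b := -hi) (by linarith) (by linarith) ?_ ?_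
    (by simpa using hmem)
  · rw [div_lt_iff₀ (by linarith)] at hlo
    rw [hcast]
    linarith
  · rw [lt_div_iff₀ (by linarith)] at hhi
    rw [hcast]
    linarith

end KobaNielsen

/-- For `N ≥ 4`, the complex Koba-Nielsen local zeta function converges (the integrand is
absolutely integrable over `ℂ^{N-3}` with Lebesgue measure) and is holomorphic in `s`
on the open set where `-2/(N-2) < Re(s_{ij}) < -2/N` for every index pair `ij`. -/
theorem kobaNielsen_complex_convergent_and_holomorphic (N : ℕ) (hN : 4 ≤ N) :
    (∀ s ∈ KNregion N (-2 / ((N : ℝ) - 2)) (-2 / (N : ℝ)),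
      Integrable (KNintegrandC N s.1 s.2.1 s.2.2)) ∧
    DifferentiableOn ℂ
      (fun s : (Fin (N - 3) → ℂ) × (Fin (N - 3) → ℂ) × (Fin (N - 3) → Fin (N - 3) → ℂ) =>
        ∫ x, KNintegrandC N s.1 s.2.1 s.2.2 x)
      (KNregion N (-2 / ((N : ℝ) - 2)) (-2 / (N : ℝ))) := by
  exact ⟨fun s hs => (KobaNielsen.integrable_and_differentiableAt_of_mem hN hs).1, fun s hs =>
    (KobaNielsen.integrable_and_differentiableAt_of_mem hN hs).2.differentiableWithinAt⟩
end
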